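/- If X is a suborderable metrizable Hausdorff space which has infinitely many connected components, then cws(X) = 1; that is, there exists a continuous weak selection σ for X whose selection topology T_σ coincides with the topology of X. -/

import Mathlib

open Topology

/-- A weak selection for `X`: a choice function on (unordered) pairs,
encoded as a symmetric map `X → X → X` picking one of its two arguments. -/
structure WeakSelection (X : Type*) where
  toFun : X → X → X
  mem_pair : ∀ x y, toFun x y = x ∨ toFun x y = y
  comm : ∀ x y, toFun x y = toFun y x

namespace WeakSelection

variable {X : Type*}

/-- `x ≤_σ y` iff `σ {x, y} = x`. -/
def le (σ : WeakSelection X) (x y : X) : Prop := σ.toFun x y = x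

/-- `x <_σ y` iff `x ≤_σ y` and `x ≠ y`. -/
def lt (σ : WeakSelection X) (x y : X) : Prop := σ.le x y ∧ x ≠ y

/-- The selection topology `T_σ`, generated by the `≤_σ`-open intervals. -/
def selTop (σ : WeakSelection X) : TopologicalSpace X :=
  TopologicalSpace.generateFrom
    {s : Set X | ∃ a : X, s = {y | σ.lt y a} ∨ s = {y | σ.lt a y}}

/-- Continuity of a weak selection on a topological space. -/
def Continuous [TopologicalSpace X] (σ : WeakSelection X) : Prop :=
  ∀ x y : X, σ.lt x y → ∃ U V : Set X, IsOpen U ∧ IsOpen V ∧ x ∈ U ∧ y ∈ V ∧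
    ∀ s ∈ U, ∀ t ∈ V, σ.lt s t

end WeakSelection

/-- `A <_g B` for subsets: `a <_g b` for all `a ∈ A`, `b ∈ B`. -/
def setLT {X : Type*} (g : WeakSelection X) (A B : Set X) : Prop :=
  ∀ a ∈ A, ∀ b ∈ B, g.lt a b

/-- `g` is the `P`-invariant weak selection `σ * h` determined by a weak
selection `σ` for the partition `P` (with block map `blk`) and weak selections
`h p` for each block `p ∈ P`: on points of distinct blocks `g` is governed by
`σ`, and within a block `p` it agrees with `h p`. -/
def IsStar {X : Type*} (P : Set (Set X)) (blk : X → Set X) (hblk : ∀ x, blk x ∈ P)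
    (σ : WeakSelection ↥P) (h : ∀ p : ↥P, WeakSelection ↥(p : Set X))
    (g : WeakSelection X) : Prop :=
  (∀ x y : X, blk x ≠ blk y →
      (g.lt x y ↔ σ.lt ⟨blk x, hblk x⟩ ⟨blk y, hblk y⟩)) ∧
  (∀ (p : ↥P) (x y : ↥(p : Set X)), blk ↑x = ↑p → blk ↑y = ↑p →
      g.toFun ↑x ↑y = ↑((h p).toFun x y))

/-- The supremum topology of the selection topologies of a family of weak
selections: the smallest topology containing all of them. -/
def supSelTop {X : Type*} (Sig : Set (WeakSelection X)) : TopologicalSpace X :=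
  TopologicalSpace.generateFrom (⋃ σ ∈ Sig, {s : Set X | IsOpen[σ.selTop] s})

/-- The cws-number of a space: the least cardinality of a collection of
continuous weak selections whose selection topologies generate the topology. -/
noncomputable def cws (X : Type*) [t : TopologicalSpace X] : Cardinal :=
  sInf {c : Cardinal | ∃ Sig : Set (WeakSelection X),
    (∀ σ ∈ Sig, σ.Continuous) ∧ supSelTop Sig = t ∧ Cardinal.mk ↥Sig = c}

/-- A Hausdorff space is suborderable (Čech) if it admits a linear order whose
open-interval topology is coarser than its topology and which has a base of
order-convex open sets. -/
def Suborderable (X : Type*) [TopologicalSpace X] : Prop :=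
  ∃ l : LinearOrder X,
    (∀ a : X, IsOpen {x | l.lt x a}) ∧ (∀ a : X, IsOpen {x | l.lt a x}) ∧
    (∀ (x : X) (U : Set X), IsOpen U → x ∈ U →
      ∃ V : Set X, IsOpen V ∧ x ∈ V ∧ V ⊆ U ∧
        ∀ a ∈ V, ∀ b ∈ V, ∀ c : X, l.le a c → l.le c b → c ∈ V)

open Set

/-- A linearly ordered space whose open rays are open and whose topology has a base of
order-convex open sets. -/
class GOSpace (X : Type*) [TopologicalSpace X] [LinearOrder X] : Prop where
  isOpen_Iio : ∀ a : X, IsOpen (Iio a)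
  isOpen_Ioi : ∀ a : X, IsOpen (Ioi a)
  exists_ordConnected : ∀ (x : X) (U : Set X), IsOpen U → x ∈ U →
    ∃ V : Set X, IsOpen V ∧ x ∈ V ∧ V ⊆ U ∧ V.OrdConnected

namespace GOSpace

section Basic

variable {X : Type*} [TopologicalSpace X] [LinearOrder X] [GOSpace X]

instance instOrderDual : GOSpace Xᵒᵈ where
  isOpen_Iio a := isOpen_Ioi (X := X) (OrderDual.ofDual a)
  isOpen_Ioi a := isOpen_Iio (X := X) (OrderDual.ofDual a)
  exists_ordConnected x U hU hx := by
    obtain ⟨V, hV, hxV, hVU, hc⟩ := exists_ordConnected (X := X) (OrderDual.ofDual x) U hU hx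
    exact ⟨V, hV, hxV, hVU, hc.dual⟩

instance : OrderClosedTopology X where
  isClosed_le' := by
    rw [← isOpen_compl_iff, isOpen_iff_mem_nhds]
    rintro ⟨a, b⟩ hab
    have hba : b < a := not_le.1 hab
    by_cases h : ∃ m, b < m ∧ m < a
    · obtain ⟨m, hbm, hma⟩ := h
      filter_upwards [prod_mem_nhds ((isOpen_Ioi m).mem_nhds hma) ((isOpen_Iio m).mem_nhds hbm)]
      rintro ⟨p, q⟩ ⟨hp, hq⟩
      exact not_le.2 (lt_trans hq hp)
    · filter_upwards [prod_mem_nhds ((isOpen_Ioi b).mem_nhds hba) ((isOpen_Iio a).mem_nhds hba)]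
      rintro ⟨p, q⟩ ⟨hp, hq⟩
      refine not_le.2 (lt_of_not_ge fun hpq => h ⟨p, hp, lt_of_le_of_lt hpq hq⟩)

theorem ordConnected_connectedComponent (x : X) : (connectedComponent x).OrdConnected :=
  ⟨fun _ ha _ hb => isPreconnected_connectedComponent.Icc_subset ha hb⟩

/-- Points of distinct components are separated by a clopen initial segment. -/
theorem exists_isClopen_isLowerSet {a b : X} (hab : a < b) (hb : b ∉ connectedComponent a) :
    ∃ D : Set X, IsClopen D ∧ IsLowerSet D ∧ a ∈ D ∧ b ∉ D := by
  have hI : ¬ IsPreconnected (Icc a b) := fun h =>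
    hb (h.subset_connectedComponent (left_mem_Icc.2 hab.le) (right_mem_Icc.2 hab.le))
  obtain ⟨u, v, hu, hv, hcov, hau, ⟨p, hpI, hpv⟩, hdisj⟩ : ∃ u v : Set X, IsOpen u ∧ IsOpen v ∧
      Icc a b ⊆ u ∪ v ∧ a ∈ u ∧ (Icc a b ∩ v).Nonempty ∧ Icc a b ∩ (u ∩ v) = ∅ := by
    simp only [IsPreconnected, not_forall, not_nonempty_iff_eq_empty] at hI
    obtain ⟨u, v, hu, hv, hcov, hnu, hnv, hd⟩ := hI
    rcases hcov (left_mem_Icc.2 hab.le) with h | h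
    · exact ⟨u, v, hu, hv, hcov, h, hnv, hd⟩
    · exact ⟨v, u, hv, hu, by rwa [union_comm], h, hnu, by rwa [inter_comm v u]⟩
  have huv : ∀ y ∈ Icc a b, y ∈ v → y ∉ u := fun y hy hyv hyu => by
    have : y ∈ Icc a b ∩ (u ∩ v) := ⟨hy, hyu, hyv⟩
    rwa [hdisj] at this
  refine ⟨{y | ∀ w, a ≤ w → w ≤ y → w ∈ u}, ⟨?_, ?_⟩, ?_, ?_, ?_⟩
  · rw [← isOpen_compl_iff, isOpen_iff_mem_nhds]
    intro y hy
    simp only [mem_compl_iff, mem_ofPred_eq, not_forall] at hy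
    obtain ⟨w, haw, hwy, hwu⟩ := hy
    rcases hwy.lt_or_eq with hlt | rfl
    · filter_upwards [(isOpen_Ioi w).mem_nhds hlt] with t ht hD
      exact hwu (hD w haw (le_of_lt ht))
    rcases le_or_gt w b with hwb | hwb
    · have hwv : w ∈ v := (hcov ⟨haw, hwb⟩).resolve_left hwu
      have haw' : a < w := lt_of_le_of_ne haw (by rintro rfl; exact hwu hau)
      filter_upwards [hv.mem_nhds hwv, (isOpen_Ioi a).mem_nhds haw'] with t htv hat hD
      rcases le_total w t with h | h
      · exact hwu (hD w haw h)
      · exact huv t ⟨le_of_lt hat, h.trans hwb⟩ htv (hD t (le_of_lt hat) le_rfl)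
    · filter_upwards [(isOpen_Ioi p).mem_nhds (lt_of_le_of_lt hpI.2 hwb)] with t ht hD
      exact huv p hpI hpv (hD p hpI.1 (le_of_lt ht))
  · rw [isOpen_iff_mem_nhds]
    intro y hy
    rcases lt_or_ge y a with hya | hay
    · filter_upwards [(isOpen_Iio a).mem_nhds hya] with t ht w haw hwt
      exact absurd (lt_of_le_of_lt (haw.trans hwt) ht) (lt_irrefl _)
    · obtain ⟨V, hV, hyV, hVu, hc⟩ := exists_ordConnected y u hu (hy y hay le_rfl)
      filter_upwards [hV.mem_nhds hyV] with t ht w haw hwt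
      rcases le_total w y with h | h
      · exact hy w haw h
      · exact hVu (hc.out hyV ht ⟨h, hwt⟩)
  · intro y z hzy hy w haw hwz
    exact hy w haw (hwz.trans hzy)
  · intro w haw hwa
    rwa [le_antisymm hwa haw]
  · intro h
    exact huv p hpI hpv (h p hpI.1 hpI.2)

theorem exists_isClopen_separating {a b : X} (h : b ∉ connectedComponent a) :
    ∃ D : Set X, IsClopen D ∧ a ∈ D ∧ b ∉ D := by
  have hne : a ≠ b := by rintro rfl; exact h mem_connectedComponent
  rcases hne.lt_or_gt with hab | hba
  · obtain ⟨D, hD, -, ha, hb⟩ := exists_isClopen_isLowerSet hab h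
    exact ⟨D, hD, ha, hb⟩
  · have h' : a ∉ connectedComponent b := fun ha =>
      h (connectedComponent_eq ha ▸ mem_connectedComponent)
    obtain ⟨D, hD, -, hb, ha⟩ := exists_isClopen_isLowerSet hba h'
    exact ⟨Dᶜ, hD.compl, ha, not_not.2 hb⟩

end Basic

section Ultraparacompact

open Relation in
/-- A relation whose links span intervals lying in members of a point-finite family has classes
that are, to the right of any point, exhausted by countably many members and initial segments. -/
theorem exists_countable_cover_right {X : Type*} [LinearOrder X] (V : X → Set X)
    (hfin : ∀ b, {i | b ∈ V i}.Finite) (R : X → X → Prop)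
    (hR : ∀ x y, R x y → ∃ i, ∀ w, x ≤ w → w ≤ y → w ∈ V i) (x₀ : X) :
    ∃ S T : Set X, S.Countable ∧ T.Countable ∧ (∀ b ∈ T, ReflTransGen R x₀ b) ∧
      ∀ y, ReflTransGen R x₀ y → (∃ i ∈ S, y ∈ V i) ∨ ∃ b ∈ T, y ≤ b := by
  let lev : ℕ → Set X := fun k => Nat.rec (motive := fun _ => Set X) {x₀}
    (fun _ s => {z | ∃ z' ∈ s, R z' z}) k
  have hlev : ∀ y, ReflTransGen R x₀ y → ∃ k, y ∈ lev k := by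
    intro y hy
    induction hy with
    | refl => exact ⟨0, rfl⟩
    | tail _ hbc ih =>
      obtain ⟨k, hk⟩ := ih
      exact ⟨k + 1, _, hk, hbc⟩
  by_cases hcof : ∃ k, ∀ y, ReflTransGen R x₀ y → ∃ z ∈ lev k, y ≤ z
  · classical
    obtain ⟨k, hk, hmin⟩ : ∃ k, (∀ y, ReflTransGen R x₀ y → ∃ z ∈ lev k, y ≤ z) ∧
        ∀ m < k, ¬ ∀ y, ReflTransGen R x₀ y → ∃ z ∈ lev m, y ≤ z :=
      ⟨Nat.find hcof, Nat.find_spec hcof, fun _ => Nat.find_min hcof⟩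
    cases k with
    | zero =>
      refine ⟨∅, {x₀}, countable_empty, countable_singleton _, ?_, fun y hy => Or.inr ?_⟩
      · rintro b rfl
        exact .refl
      · obtain ⟨z, hz₀, hz⟩ := hk y hy
        exact ⟨z, hz₀, hz⟩
    | succ k =>
      obtain ⟨b, hb⟩ := not_forall.1 (hmin k (Nat.lt_succ_self k))
      obtain ⟨hbE, hb⟩ := Classical.not_imp.1 hb
      refine ⟨{i | b ∈ V i}, {b}, (hfin b).countable, countable_singleton _, ?_, fun y hy => ?_⟩
      · rintro _ rfl
        exact hbE
      rcases le_total y b with hyb | hby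
      · exact Or.inr ⟨b, rfl, hyb⟩
      · obtain ⟨z, ⟨z', hz', hRz⟩, hyz⟩ := hk y hy
        obtain ⟨i, hi⟩ := hR z' z hRz
        have hz'b : z' ≤ b := le_of_not_ge fun h => hb ⟨z', hz', h⟩
        exact Or.inl ⟨i, hi b hz'b (hby.trans hyz), hi y (hz'b.trans hby) hyz⟩
  · have : ∀ k, ∃ b, ReflTransGen R x₀ b ∧ ∀ z ∈ lev k, z < b := by
      intro k
      by_contra! h
      exact hcof ⟨k, fun y hy => h y hy⟩
    choose b hbE hb using this
    refine ⟨∅, range b, countable_empty, countable_range b, ?_, fun y hy => Or.inr ?_⟩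
    · rintro _ ⟨k, rfl⟩
      exact hbE k
    · obtain ⟨k, hk⟩ := hlev y hy
      exact ⟨b k, ⟨k, rfl⟩, (hb k y hk).le⟩

variable {X : Type*} [TopologicalSpace X]

/-- On `A`, membership in the family `W` is witnessed by a locally constant choice of index. -/
def SelectableOn (W : X → Set X) (A : Set X) : Prop :=
  ∃ f : X → X, ∀ x ∈ A, (∀ᶠ y in 𝓝 x, f y = f x) ∧ x ∈ W (f x)

theorem SelectableOn.mono {W : X → Set X} {A B : Set X} (h : SelectableOn W B) (hAB : A ⊆ B) :
    SelectableOn W A :=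
  let ⟨f, hf⟩ := h
  ⟨f, fun x hx => hf x (hAB hx)⟩

theorem selectableOn_self (W : X → Set X) (i : X) : SelectableOn W (W i) :=
  ⟨fun _ => i, fun _ hx => ⟨.of_forall fun _ => rfl, hx⟩⟩

theorem SelectableOn.iUnion {W : X → Set X} {A : ℕ → Set X} (hA : ∀ k, IsClopen (A k))
    (h : ∀ k, SelectableOn W (A k)) : SelectableOn W (⋃ k, A k) := by
  classical
  choose f hf using h
  refine ⟨fun x => if hx : ∃ k, x ∈ A k then f (Nat.find hx) x else x, fun x hx => ?_⟩
  have hx' : ∃ k, x ∈ A k := mem_iUnion.1 hx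
  obtain ⟨hk, hmin⟩ := And.intro (Nat.find_spec hx') (fun m => Nat.find_min (m := m) hx')
  have hev : ∀ᶠ y in 𝓝 x, ∀ m < Nat.find hx', y ∉ A m :=
    (Filter.eventually_all_finite (finite_lt_nat _)).2 fun m hm =>
      (hA m).compl.isOpen.mem_nhds (hmin m hm)
  simp only [hx', dite_true]
  refine ⟨?_, (hf _ x hk).2⟩
  filter_upwards [hev, (hA _).isOpen.mem_nhds hk, (hf _ x hk).1] with y hy hyk hfy
  have hy' : ∃ k, y ∈ A k := ⟨_, hyk⟩
  have : Nat.find hy' = Nat.find hx' := (Nat.find_eq_iff hy').2 ⟨hyk, hy⟩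
  simp only [hy', dite_true, this, hfy]

theorem SelectableOn.sUnion {W : X → Set X} {𝒜 : Set (Set X)} (hc : 𝒜.Countable)
    (hA : ∀ A ∈ 𝒜, IsClopen A ∧ SelectableOn W A) : SelectableOn W (⋃₀ 𝒜) := by
  rcases 𝒜.eq_empty_or_nonempty with rfl | hne
  · exact ⟨id, by simp⟩
  · obtain ⟨g, rfl⟩ := hc.exists_eq_range hne
    rw [sUnion_range]
    exact .iUnion (fun k => (hA _ ⟨k, rfl⟩).1) (fun k => (hA _ ⟨k, rfl⟩).2)

variable [LinearOrder X] [GOSpace X]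

open Relation in
/-- A clopen cover of a paracompact GO-space admits a locally constant choice of members. -/
theorem exists_isLocallyConstant_mem [ParacompactSpace X] (W : X → Set X)
    (hW : ∀ x, IsClopen (W x)) (hx : ∀ x, x ∈ W x) :
    ∃ f : X → X, IsLocallyConstant f ∧ ∀ x, x ∈ W (f x) := by
  obtain ⟨V, hVo, hVc, hVf, hVW⟩ := precise_refinement W (fun x => (hW x).isOpen)
    (iUnion_eq_univ_iff.2 fun x => ⟨x, hx x⟩)
  have hfin := hVf.point_finite
  let R : X → X → Prop := fun x y => ∃ i, uIcc x y ⊆ V i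
  have hRs : Std.Symm R := ⟨fun x y ⟨i, hi⟩ => ⟨i, by rwa [uIcc_comm]⟩⟩
  have hRn : ∀ x, ∀ᶠ y in 𝓝 x, R x y := fun x => by
    obtain ⟨i, hi⟩ := iUnion_eq_univ_iff.1 hVc x
    obtain ⟨O, hO, hxO, hOV, hc⟩ := exists_ordConnected x _ (hVo i) hi
    filter_upwards [hO.mem_nhds hxO] with y hy
    exact ⟨i, (hc.uIcc_subset hxO hy).trans hOV⟩
  have hchain : ∀ x y, ReflTransGen R x y → ∃ A, IsClopen A ∧ SelectableOn W A ∧ uIcc x y ⊆ A := by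
    intro x y hxy
    induction hxy with
    | refl => exact ⟨W x, hW x, selectableOn_self W x, by simpa using hx x⟩
    | tail _ hbc ih =>
      obtain ⟨A, hA, hsel, hsub⟩ := ih
      obtain ⟨i, hi⟩ := hbc
      refine ⟨A ∪ W i, hA.union (hW i), ?_, ?_⟩
      · rw [← sUnion_pair]
        refine .sUnion (by simp) ?_
        rintro B (rfl | rfl)
        exacts [⟨hA, hsel⟩, ⟨hW i, selectableOn_self W i⟩]
      · exact uIcc_subset_uIcc_union_uIcc.trans
          (union_subset_union hsub (hi.trans (hVW i)))
  have hclass : ∀ x, SelectableOn W {y | ReflTransGen R x y} := by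
    intro x
    obtain ⟨S, T, hS, hT, hTE, hr⟩ := exists_countable_cover_right V hfin R
      (fun a b ⟨i, hi⟩ => ⟨i, fun w h₁ h₂ => hi (Icc_subset_uIcc ⟨h₁, h₂⟩)⟩) x
    obtain ⟨S', T', hS', hT', hTE', hl⟩ := exists_countable_cover_right (X := Xᵒᵈ) V hfin R
      (fun a b ⟨i, hi⟩ => ⟨i, fun w h₁ h₂ => hi (Icc_subset_uIcc' ⟨h₂, h₁⟩)⟩) x
    choose! A hA hAs hAsub using hchain x
    refine (SelectableOn.sUnion (W := W) (𝒜 := W '' (S ∪ S') ∪ A '' (T ∪ T'))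
      (((hS.union hS').image _).union ((hT.union hT').image _)) ?_).mono ?_
    · rintro _ (⟨i, -, rfl⟩ | ⟨b, hb, rfl⟩)
      · exact ⟨hW i, selectableOn_self W i⟩
      · have hb' : ReflTransGen R x b := hb.elim (hTE b) (hTE' b)
        exact ⟨hA b hb', hAs b hb'⟩
    · intro y hy
      rcases le_total x y with hxy | hyx
      · rcases hr y hy with ⟨i, hi, hyi⟩ | ⟨b, hb, hyb⟩
        · exact ⟨W i, Or.inl ⟨i, Or.inl hi, rfl⟩, hVW i hyi⟩
        · exact ⟨A b, Or.inr ⟨b, Or.inl hb, rfl⟩,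
            hAsub b (hTE b hb) (Icc_subset_uIcc ⟨hxy, hyb⟩)⟩
      · rcases hl y hy with ⟨i, hi, hyi⟩ | ⟨b, hb, hyb⟩
        · exact ⟨W i, Or.inl ⟨i, Or.inr hi, rfl⟩, hVW i hyi⟩
        · exact ⟨A b, Or.inr ⟨b, Or.inr hb, rfl⟩,
            hAsub b (hTE' b hb) (Icc_subset_uIcc' ⟨hyb, hyx⟩)⟩
  choose f hf using hclass
  let s : Setoid X :=
    ⟨ReflTransGen R, fun _ => .refl, fun h => Std.Symm.symm _ _ h, fun h h' => h.trans h'⟩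
  have hrep : ∀ x, ReflTransGen R (Quotient.mk s x).out x := fun x =>
    Quotient.exact (Quotient.out_eq (Quotient.mk s x))
  refine ⟨fun x => f (Quotient.mk s x).out x, ?_, fun x => (hf _ x (hrep x)).2⟩
  rw [IsLocallyConstant.iff_eventually_eq]
  intro x
  filter_upwards [hRn x, (hf _ x (hrep x)).1] with y hxy hy
  have : Quotient.mk s y = Quotient.mk s x :=
    Quotient.sound (s := s) (Std.Symm.symm _ _ (ReflTransGen.single hxy))
  rw [this, hy]

end Ultraparacompact

section Small

variable {X : Type*} [TopologicalSpace X] [LinearOrder X]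

/-- The points lying above the component of `x`. -/
def above (x : X) : Set X := {y | ∀ c ∈ connectedComponent x, c < y}

/-- The points lying below the component of `x`. -/
def below (x : X) : Set X := {y | ∀ c ∈ connectedComponent x, y < c}

theorem notMem_of_mem_above {x y : X} (h : y ∈ above x) : y ∉ connectedComponent x :=
  fun hy => lt_irrefl _ (h y hy)

theorem notMem_of_mem_below {x y : X} (h : y ∈ below x) : y ∉ connectedComponent x :=
  fun hy => lt_irrefl _ (h y hy)

variable [GOSpace X]

theorem mem_above_of_lt {x y c : X} (hc : c ∈ connectedComponent x) (hcy : c ≤ y)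
    (hy : y ∉ connectedComponent x) : y ∈ above x := fun _ hc' =>
  lt_of_not_ge fun h => hy ((ordConnected_connectedComponent x).out hc hc' ⟨hcy, h⟩)

theorem mem_below_of_lt {x y c : X} (hc : c ∈ connectedComponent x) (hcy : y ≤ c)
    (hy : y ∉ connectedComponent x) : y ∈ below x := fun _ hc' =>
  lt_of_not_ge fun h => hy ((ordConnected_connectedComponent x).out hc' hc ⟨h, hcy⟩)

theorem mem_above_or_mem_below {x y : X} (hy : y ∉ connectedComponent x) :
    y ∈ above x ∨ y ∈ below x :=
  (le_total x y).imp (fun h => mem_above_of_lt mem_connectedComponent h hy)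
    (fun h => mem_below_of_lt mem_connectedComponent h hy)

theorem exists_isGreatest_of_not_isClosed_above {x : X} (h : ¬ IsClosed (above x)) :
    ∃ M, IsGreatest (connectedComponent x) M ∧ M ∈ closure (above x) := by
  obtain ⟨M, hM, hM'⟩ : ∃ M ∈ closure (above x), M ∉ above x := by
    by_contra! h'
    exact h (isClosed_of_closure_subset h')
  have hup : M ∈ upperBounds (connectedComponent x) := fun c hc => by
    refine le_of_not_gt fun hlt => ?_
    obtain ⟨y, hyc, hy⟩ := mem_closure_iff.1 hM _ (isOpen_Iio c) hlt
    exact lt_asymm hyc (hy c hc)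
  obtain ⟨c, hc, hMc⟩ : ∃ c ∈ connectedComponent x, M ≤ c := by
    by_contra! h'
    exact hM' h'
  exact ⟨M, ⟨le_antisymm hMc (hup hc) ▸ hc, hup⟩, hM⟩

theorem isOpen_above (x : X) : IsOpen (above x) := by
  refine isOpen_iff_mem_nhds.2 fun y hy => ?_
  obtain ⟨V, hV, hyV, hVC, hc⟩ := exists_ordConnected y _
    isClosed_connectedComponent.isOpen_compl (notMem_of_mem_above hy)
  filter_upwards [hV.mem_nhds hyV] with t ht c hcx
  exact lt_of_not_ge fun h => hVC (hc.out ht hyV ⟨h, (hy c hcx).le⟩) hcx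

theorem exists_isClopen_above (x : X) (U : X → Set X) (hU : ∀ x, U x ∈ 𝓝 x) :
    ∃ D : Set X, IsClopen D ∧ connectedComponent x ⊆ D ∧ ∀ y ∈ D, y ∈ above x →
      ¬ IsClosed (above x) ∧ ∃ M, IsGreatest (connectedComponent x) M ∧ y ∈ U M := by
  by_cases h : IsClosed (above x)
  · exact ⟨(above x)ᶜ, ⟨(isOpen_above x).isClosed_compl, h.isOpen_compl⟩,
      fun y hy hy' => notMem_of_mem_above hy' hy, fun y hy hy' => absurd hy' hy⟩
  obtain ⟨M, hM, hMc⟩ := exists_isGreatest_of_not_isClosed_above h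
  obtain ⟨V, hV, hMV, hVU, hc⟩ := exists_ordConnected M (interior (U M)) isOpen_interior
    (mem_interior_iff_mem_nhds.2 (hU M))
  obtain ⟨u, huV, hu⟩ := mem_closure_iff.1 hMc V hV hMV
  have huM : u ∉ connectedComponent M := by
    rw [← connectedComponent_eq hM.1]
    exact notMem_of_mem_above hu
  obtain ⟨D, hD, hDl, hMD, huD⟩ := exists_isClopen_isLowerSet (hu M hM.1) huM
  refine ⟨D, hD, ?_, fun y hy hy' => ⟨h, M, hM, ?_⟩⟩
  · rw [connectedComponent_eq hM.1]
    exact hD.connectedComponent_subset hMD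
  · refine interior_subset (hVU (hc.out hMV huV ⟨(hy' M hM.1).le, ?_⟩))
    exact le_of_not_ge fun huy => huD (hDl huy hy)

end Small

section Metric

variable {X : Type*} [MetricSpace X] [LinearOrder X]

/-- `W` is a clopen neighbourhood of the component of `x` whose part above (below) the component
is empty if that side is clopen, and otherwise is `ε`-close to the end point of the component. -/
structure IsSmallNhd (ε : ℝ) (x : X) (W : Set X) : Prop where
  isClopen : IsClopen W
  above : ∀ y ∈ W, y ∈ above x →
    ¬ IsClosed (GOSpace.above x) ∧ ∃ M, IsGreatest (connectedComponent x) M ∧ dist M y < ε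
  below : ∀ y ∈ W, y ∈ below x →
    ¬ IsClosed (GOSpace.below x) ∧ ∃ m, IsLeast (connectedComponent x) m ∧ dist m y < ε

theorem IsSmallNhd.mono {ε ε' : ℝ} {x : X} {W : Set X} (h : IsSmallNhd ε x W) (hε : ε ≤ ε') :
    IsSmallNhd ε' x W where
  isClopen := h.isClopen
  above y hy hy' := let ⟨h₁, M, hM, hd⟩ := h.above y hy hy'; ⟨h₁, M, hM, hd.trans_le hε⟩
  below y hy hy' := let ⟨h₁, M, hM, hd⟩ := h.below y hy hy'; ⟨h₁, M, hM, hd.trans_le hε⟩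

theorem IsSmallNhd.dual {ε : ℝ} {x : X} {W : Set X} (h : IsSmallNhd ε x W) :
    IsSmallNhd (X := Xᵒᵈ) ε x W where
  isClopen := h.isClopen
  above := h.below
  below := h.above

theorem IsSmallNhd.dist_lt_of_above {ε : ℝ} {w x y : X} {W : Set X} (h : IsSmallNhd ε w W)
    (hx : x ∈ W) (hy : y ∈ W) (hxw : x ∈ GOSpace.above w) (hyw : y ∈ GOSpace.above w) :
    dist x y < 2 * ε := by
  obtain ⟨-, M, hM, hMx⟩ := h.above x hx hxw
  obtain ⟨-, M', hM', hMy⟩ := h.above y hy hyw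
  obtain rfl := hM.unique hM'
  linarith [dist_triangle_left x y M]

theorem IsSmallNhd.dist_lt_of_below {ε : ℝ} {w x y : X} {W : Set X} (h : IsSmallNhd ε w W)
    (hx : x ∈ W) (hy : y ∈ W) (hxw : x ∈ GOSpace.below w) (hyw : y ∈ GOSpace.below w) :
    dist x y < 2 * ε :=
  h.dual.dist_lt_of_above hx hy hxw hyw

variable [GOSpace X]

theorem exists_isSmallNhd {ε : ℝ} (hε : 0 < ε) (x : X) :
    ∃ W, x ∈ W ∧ IsSmallNhd ε x W := by
  have hU : ∀ x : X, {y | dist x y < ε} ∈ 𝓝 x := fun x => by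
    filter_upwards [Metric.ball_mem_nhds x hε] with y hy using Metric.mem_ball'.1 hy
  obtain ⟨D, hD, hxD, hDr⟩ := exists_isClopen_above x _ hU
  obtain ⟨D', hD', hxD', hDl⟩ := exists_isClopen_above (X := Xᵒᵈ) x _ hU
  exact ⟨D ∩ D', ⟨hxD mem_connectedComponent, hxD' mem_connectedComponent⟩, hD.inter hD',
    fun y hy => hDr y hy.1, fun y hy => hDl y hy.2⟩

theorem IsSmallNhd.mem_connectedComponent {ε : ℝ} {w x u v : X} {W : Set X}
    (h : IsSmallNhd ε w W) (hx : x ∈ W) (hu : u ∈ connectedComponent x)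
    (hv : v ∈ connectedComponent x) (huv : 2 * ε ≤ dist u v) : w ∈ connectedComponent x := by
  by_contra hw
  have hsub := h.isClopen.connectedComponent_subset hx
  have key : ∀ c ∈ connectedComponent x, c ∉ connectedComponent w := fun c hc hc' => by
    rw [connectedComponent_eq hc, ← connectedComponent_eq hc'] at hw
    exact hw _root_.mem_connectedComponent
  rcases mem_above_or_mem_below hw with hwa | hwb
  · have : ∀ c ∈ connectedComponent x, c ∈ GOSpace.below w := fun c hc =>
      mem_below_of_lt _root_.mem_connectedComponent (hwa c hc).le (key c hc)
    exact absurd (h.dist_lt_of_below (hsub hu) (hsub hv) (this u hu) (this v hv)) (not_lt.2 huv)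
  · have : ∀ c ∈ connectedComponent x, c ∈ GOSpace.above w := fun c hc =>
      mem_above_of_lt _root_.mem_connectedComponent (hwb c hc).le (key c hc)
    exact absurd (h.dist_lt_of_above (hsub hu) (hsub hv) (this u hu) (this v hv)) (not_lt.2 huv)

theorem exists_forall_isSmallNhd_notMem_above {x : X} (hx : IsClosed (above x)) :
    ∃ ε > 0, ∀ w W, IsSmallNhd ε w W → x ∈ W → ∀ y ∈ W, y ∉ above x := by
  obtain ⟨ε, hε, hball⟩ := Metric.isOpen_iff.1 hx.isOpen_compl x
    (fun h => notMem_of_mem_above h mem_connectedComponent)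
  refine ⟨ε / 2, half_pos hε, fun w W hW hxW y hyW hy => ?_⟩
  have hfar : ∀ z ∈ above x, ε ≤ dist z x := fun z hz =>
    le_of_not_gt fun h => hball (Metric.mem_ball.2 h) hz
  by_cases hw : x ∈ connectedComponent w
  · have : above w = above x := by rw [above, above, connectedComponent_eq hw]
    exact (this ▸ (hW.above y hyW (this ▸ hy)).1) hx
  rcases mem_above_or_mem_below hw with hwa | hwb
  · have := hW.dist_lt_of_above hyW hxW
      (fun c hc => (hwa c hc).trans (hy x mem_connectedComponent)) hwa
    linarith [hfar y hy]
  · obtain ⟨-, m, hm, hd⟩ := hW.below x hxW hwb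
    have hmx : m ∈ above x := mem_above_of_lt mem_connectedComponent (hwb m hm.1).le fun h => by
      rw [connectedComponent_eq hm.1, ← connectedComponent_eq h] at hw
      exact hw mem_connectedComponent
    linarith [hfar m hmx]

theorem exists_forall_isSmallNhd_notMem {x z : X} (hxz : x < z) (hz : z ∉ connectedComponent x) :
    ∃ ε > 0, ∀ w W, IsSmallNhd ε w W → x ∈ W → z ∉ W := by
  have hx : x ∉ connectedComponent z := fun h =>
    hz (connectedComponent_eq h ▸ mem_connectedComponent)
  obtain ⟨δ₁, hδ₁, hb₁⟩ := Metric.isOpen_iff.1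
    (isClosed_connectedComponent (x := x)).isOpen_compl z hz
  obtain ⟨δ₂, hδ₂, hb₂⟩ := Metric.isOpen_iff.1
    (isClosed_connectedComponent (x := z)).isOpen_compl x hx
  have hd : 0 < dist x z := dist_pos.2 hxz.ne
  obtain ⟨δ₃, hδ₃, hmid⟩ : ∃ ε > 0, ∀ w W, IsSmallNhd ε w W → x ∈ W → z ∈ W →
      x ∈ below w → z ∈ above w → False := by
    by_cases h : ∃ w W, IsSmallNhd 1 w W ∧ x ∈ W ∧ z ∈ W ∧ x ∈ below w ∧ z ∈ above w
    · obtain ⟨v, V, hV, hxV, hzV, hxv, hzv⟩ := h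
      obtain ⟨-, m, hm, -⟩ := hV.below x hxV hxv
      obtain ⟨α, hα, hbα⟩ := Metric.isOpen_iff.1 (isOpen_Iio m) x (hxv m hm.1)
      obtain ⟨β, hβ, hbβ⟩ := Metric.isOpen_iff.1 (isOpen_Ioi m) z (hzv m hm.1)
      refine ⟨min α β, lt_min hα hβ, fun w W hW hxW hzW hxw hzw => ?_⟩
      obtain ⟨-, l, hl, hlx⟩ := hW.below x hxW hxw
      obtain ⟨-, M, hM, hMz⟩ := hW.above z hzW hzw
      have hlm : l < m := hbα (Metric.mem_ball.2 (hlx.trans_le (min_le_left _ _)))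
      have hmM : m < M := hbβ (Metric.mem_ball.2 (hMz.trans_le (min_le_right _ _)))
      have hmw : m ∈ connectedComponent w :=
        (ordConnected_connectedComponent w).out hl.1 hM.1 ⟨hlm.le, hmM.le⟩
      have : connectedComponent w = connectedComponent v := by
        rw [connectedComponent_eq hmw, connectedComponent_eq hm.1]
      exact absurd (hm.2 (this ▸ hl.1)) (not_le.2 hlm)
    · exact ⟨1, one_pos, fun w W hW hxW hzW hxw hzw => h ⟨w, W, hW, hxW, hzW, hxw, hzw⟩⟩
  refine ⟨min (min δ₁ δ₂) (min (dist x z / 2) δ₃),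
    lt_min (lt_min hδ₁ hδ₂) (lt_min (half_pos hd) hδ₃), fun w W hW hxW hzW => ?_⟩
  have hW₁ : IsSmallNhd δ₁ w W := hW.mono ((min_le_left _ _).trans (min_le_left _ _))
  have hW₂ : IsSmallNhd δ₂ w W := hW.mono ((min_le_left _ _).trans (min_le_right _ _))
  have hWd : IsSmallNhd (dist x z / 2) w W := hW.mono ((min_le_right _ _).trans (min_le_left _ _))
  have hW₃ : IsSmallNhd δ₃ w W := hW.mono ((min_le_right _ _).trans (min_le_right _ _))
  by_cases hxw : x ∈ connectedComponent w
  · have hC := connectedComponent_eq hxw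
    obtain ⟨-, M, hM, hMz⟩ := hW₁.above z hzW
      (mem_above_of_lt hxw hxz.le (hC ▸ hz))
    exact hb₁ (Metric.mem_ball.2 hMz) (hC ▸ hM.1)
  by_cases hzw : z ∈ connectedComponent w
  · have hC := connectedComponent_eq hzw
    obtain ⟨-, m, hm, hmx⟩ := hW₂.below x hxW
      (mem_below_of_lt hzw hxz.le (hC ▸ hx))
    exact hb₂ (Metric.mem_ball.2 hmx) (hC ▸ hm.1)
  rcases mem_above_or_mem_below hxw with hxa | hxb
  · have := hWd.dist_lt_of_above hxW hzW hxa fun c hc => (hxa c hc).trans hxz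
    linarith
  rcases mem_above_or_mem_below hzw with hza | hzb
  · exact hmid w W hW₃ hxW hzW hxb hza
  · have := hWd.dist_lt_of_below hxW hzW (fun c hc => hxz.trans (hzb c hc)) hzb
    linarith

end Metric

end GOSpace

section Tournament

/-- A tournament on `I` in which every vertex is recognised by its relation to finitely many
other vertices, and in which some finite set of vertices dominates all vertices. -/
structure IsRecognizingTournament {Q : Type*} (I : Set Q) (T : Q → Q → Prop) : Prop where
  asymm : ∀ i ∈ I, ∀ j ∈ I, i ≠ j → (T i j ↔ ¬ T j i)
  separate : ∀ i ∈ I, ∃ F ⊆ I, F.Finite ∧ i ∉ F ∧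
    ∀ j ∈ I, j ≠ i → ∃ a ∈ F, a ≠ j ∧ ¬ (T a i ↔ T a j)
  dominate : ∃ D ⊆ I, D.Finite ∧ ∀ i ∈ I, ∃ a ∈ D, a ≠ i ∧ T a i

/-- The order of `ℕ` with consecutive elements swapped. -/
def swapLT (i j : ℕ) : Prop := i + 2 ≤ j ∨ i = j + 1

theorem isRecognizingTournament_fin {N : ℕ} (hN : 5 ≤ N) :
    IsRecognizingTournament (univ : Set (Fin N)) fun i j => swapLT i j where
  asymm i _ j _ hij := by
    have := Fin.val_ne_of_ne hij
    unfold swapLT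
    omega
  separate i _ := by
    refine ⟨{i}ᶜ, subset_univ _, toFinite _, by simp, fun j _ hji => ?_⟩
    obtain ⟨i, hi⟩ := i
    obtain ⟨j, hj⟩ := j
    have hne : j ≠ i := fun h => hji (Fin.ext h)
    clear hji
    obtain ⟨a, ha, hai, haj, h⟩ : ∃ a < N, a ≠ i ∧ a ≠ j ∧ ¬ (swapLT a i ↔ swapLT a j) := by
      unfold swapLT
      wlog hlt : i < j generalizing i j
      · obtain ⟨a, ha, h₁, h₂, h₃⟩ := this j hj trivial i hi trivial hne.symm (by omega)
        exact ⟨a, ha, h₂, h₁, by tauto⟩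
      by_cases h₂ : j = i + 2
      · exact ⟨i + 1, by omega⟩
      by_cases h₄ : i + 4 ≤ j
      · exact ⟨i + 2, by omega⟩
      by_cases hN : j + 1 < N
      · exact ⟨j + 1, by omega⟩
      · exact ⟨i - 1, by omega⟩
    exact ⟨⟨a, ha⟩, by simpa using hai, by simpa using haj, h⟩
  dominate := by
    refine ⟨univ, subset_rfl, toFinite _, ?_⟩
    rintro ⟨i, hi⟩ -
    obtain ⟨a, ha, hai, h⟩ : ∃ a < N, a ≠ i ∧ swapLT a i := by
      unfold swapLT
      by_cases h₂ : 2 ≤ i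
      · exact ⟨0, by omega⟩
      · exact ⟨i + 1, by omega⟩
    exact ⟨⟨a, ha⟩, mem_univ _, by simpa using hai, h⟩

theorem isRecognizingTournament_prod_nat {J : Type*} [LinearOrder J] [OrderBot J] :
    IsRecognizingTournament (univ : Set (J × ℕ))
      fun p q => p.1 < q.1 ∨ p.1 = q.1 ∧ swapLT p.2 q.2 where
  asymm := by
    rintro ⟨α, i⟩ - ⟨β, j⟩ - hij
    rcases lt_trichotomy α β with h | rfl | h
    · simp [h, h.ne', h.not_gt]
    · have : i ≠ j := fun h => hij (by rw [h])
      simp only [swapLT, lt_irrefl, true_and, false_or]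
      omega
    · simp [h, h.ne', h.not_gt]
  separate := by
    rintro ⟨α, i⟩ -
    refine ⟨{(α, i + 1), (α, i + 2), (α, i + 4)}, subset_univ _, toFinite _, by simp, ?_⟩
    rintro ⟨β, j⟩ - hji
    rcases lt_trichotomy α β with h | rfl | h
    · exact ⟨(α, i + 2), by simp, by simp [h.ne], by simp [h, swapLT]; omega⟩
    · have hne : j ≠ i := fun h => hji (by rw [h])
      obtain ⟨k, hk, hkj, hsw⟩ : ∃ k ∈ ({1, 2, 4} : Set ℕ), i + k ≠ j ∧
          ¬ (swapLT (i + k) i ↔ swapLT (i + k) j) := by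
        unfold swapLT
        by_cases h₁ : j < i ∨ j = i + 2
        · exact ⟨1, by simp, by omega⟩
        by_cases h₃ : j = i + 3
        · exact ⟨4, by simp, by omega⟩
        · exact ⟨2, by simp, by omega⟩
      refine ⟨(α, i + k), ?_, by simpa using hkj, by simpa using hsw⟩
      rcases hk with rfl | rfl | rfl <;> simp
    · exact ⟨(α, i + 1), by simp, by simp [h.ne'], by simp [h.ne', h.not_gt, swapLT]⟩
  dominate := by
    refine ⟨{(⊥, 0), (⊥, 1), (⊥, 2)}, subset_univ _, toFinite _, ?_⟩
    rintro ⟨β, j⟩ -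
    rcases (bot_le (a := β)).lt_or_eq with h | rfl
    · exact ⟨(⊥, 0), by simp, by simp [h.ne], by simp [h]⟩
    · by_cases h₂ : 2 ≤ j
      · exact ⟨(⊥, 0), by simp, by simp; omega, by simp [swapLT]; omega⟩
      · refine ⟨(⊥, j + 1), ?_, by simp, by simp [swapLT]⟩
        have : j = 0 ∨ j = 1 := by omega
        rcases this with rfl | rfl <;> simp

theorem IsRecognizingTournament.map {J Q : Type*} {T : J → J → Prop}
    (h : IsRecognizingTournament univ T) {φ : J → Q} {ψ : Q → J} (hφ : Function.LeftInverse ψ φ) :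
    IsRecognizingTournament (range φ) fun a b => T (ψ a) (ψ b) where
  asymm := by
    rintro _ ⟨i, rfl⟩ _ ⟨j, rfl⟩ hij
    simpa only [hφ i, hφ j] using h.asymm i trivial j trivial fun e => hij (by rw [e])
  separate := by
    rintro _ ⟨i, rfl⟩
    obtain ⟨F, -, hF, hiF, hsep⟩ := h.separate i trivial
    refine ⟨φ '' F, image_subset_range _ _, hF.image _, ?_, ?_⟩
    · rintro ⟨a, ha, hai⟩
      exact hiF (hφ.injective hai ▸ ha)
    · rintro _ ⟨j, rfl⟩ hji
      obtain ⟨a, ha, haj, hT⟩ := hsep j trivial fun e => hji (by rw [e])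
      exact ⟨φ a, ⟨a, ha, rfl⟩, fun e => haj (hφ.injective e), by simpa only [hφ _] using hT⟩
  dominate := by
    obtain ⟨D, -, hD, hdom⟩ := h.dominate
    refine ⟨φ '' D, image_subset_range _ _, hD.image _, ?_⟩
    rintro _ ⟨i, rfl⟩
    obtain ⟨a, ha, hai, hT⟩ := hdom i trivial
    exact ⟨φ a, ⟨a, ha, rfl⟩, fun e => hai (hφ.injective e), by simpa only [hφ _] using hT⟩

theorem exists_isRecognizingTournament {Q : Type*} (I : Set Q)
    (hI : I = ∅ ∨ ∃ e : Fin 5 → Q, Function.Injective e ∧ ∀ k, e k ∈ I) :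
    ∃ T, IsRecognizingTournament I T := by
  rcases hI with rfl | ⟨e, he, heI⟩
  · exact ⟨fun _ _ => True, by simp, by simp, ∅, by simp⟩
  have : Nonempty I := ⟨⟨e 0, heI 0⟩⟩
  suffices ∃ (J : Type _) (T : J → J → Prop), IsRecognizingTournament univ T ∧ Nonempty (J ≃ I) by
    obtain ⟨J, T, hT, ⟨φ⟩⟩ := this
    have : Nonempty J := φ.nonempty
    have hinj : Function.Injective fun j => (φ j : Q) := Subtype.val_injective.comp φ.injective
    have hr : range (fun j => (φ j : Q)) = I := by
      ext q
      exact ⟨by rintro ⟨j, rfl⟩; exact (φ j).2, fun hq => ⟨φ.symm ⟨q, hq⟩, by simp⟩⟩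
    exact ⟨_, hr ▸ hT.map (Function.leftInverse_invFun hinj)⟩
  rcases finite_or_infinite I with hfin | hinf
  · obtain ⟨N, ⟨φ⟩⟩ := Finite.exists_equiv_fin I
    have hN : 5 ≤ N := by
      have : Function.Injective fun k => φ ⟨e k, heI k⟩ := fun a b hab =>
        he (congrArg Subtype.val (φ.injective hab))
      simpa using Fintype.card_le_of_injective _ this
    have h := (isRecognizingTournament_fin hN).map (φ := ULift.up) (ψ := ULift.down) fun _ => rfl
    rw [ULift.up_surjective.range_eq] at h
    exact ⟨ULift (Fin N), _, h, ⟨Equiv.ulift.trans φ.symm⟩⟩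
  · obtain ⟨_, hwf⟩ := exists_wellFoundedLT I
    let := WellFoundedLT.toOrderBot I
    refine ⟨I × ℕ, _, isRecognizingTournament_prod_nat, Cardinal.eq.1 ?_⟩
    simp [Cardinal.mul_aleph0_eq (Cardinal.aleph0_le_mk I)]

end Tournament

namespace GOSpace

section Partition

/-- The set consists of a single component or meets infinitely many components. -/
def IsGood {X : Type*} [TopologicalSpace X] (K : Set X) : Prop :=
  (∀ x ∈ K, ∀ y ∈ K, connectedComponent x = connectedComponent y) ∨
    (connectedComponent '' K).Infinite

variable {X : Type*} [LinearOrder X]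

/-- Two points are related if `F` is constant on the interval between them. -/
def intervalSetoid {ι : Type*} (F : X → ι) : Setoid X where
  r x y := ∀ w ∈ uIcc x y, F w = F x
  iseqv := by
    refine ⟨fun x w hw => ?_, fun {x y} h w hw => ?_, fun {x y z} hxy hyz w hw => ?_⟩
    · rw [uIcc_self, mem_singleton_iff] at hw
      rw [hw]
    · rw [h w (uIcc_comm y x ▸ hw), h y right_mem_uIcc]
    · rcases uIcc_subset_uIcc_union_uIcc hw with h | h
      · exact hxy w h
      · rw [hyz w h, hxy y right_mem_uIcc]

theorem ordConnected_intervalSetoid {ι : Type*} (F : X → ι) (x : X) :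
    OrdConnected {y | intervalSetoid F x y} := by
  refine ⟨fun y hy z hz w hw v hv => ?_⟩
  rcases uIcc_subset_uIcc_union_uIcc (b := x) (Icc_subset_uIcc hw) with h | h
  · exact hy v (uIcc_subset_uIcc_left (uIcc_comm x y ▸ h) hv)
  · exact hz v (uIcc_subset_uIcc_left h hv)

variable [TopologicalSpace X] [GOSpace X]

theorem isOpen_intervalSetoid {ι : Type*} {F : X → ι} (hF : IsLocallyConstant F) (x : X) :
    IsOpen {y | intervalSetoid F x y} := by
  refine isOpen_iff_mem_nhds.2 fun y hy => ?_
  obtain ⟨V, hV, hyV, hVF, hc⟩ :=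
    exists_ordConnected y (F ⁻¹' {F y}) (hF.isOpen_fiber (F y)) rfl
  filter_upwards [hV.mem_nhds hyV] with z hz
  exact (intervalSetoid F).trans hy fun w hw => hVF (hc.uIcc_subset hyV hz hw)

theorem isClopen_of_setoid {X : Type*} [TopologicalSpace X] (r : Setoid X)
    (hr : ∀ x, IsOpen {y | r x y}) (x : X) : IsClopen {y | r x y} := by
  refine ⟨⟨isOpen_iff_mem_nhds.2 fun y hy => ?_⟩, hr x⟩
  filter_upwards [(hr y).mem_nhds (r.refl y)] with z hz hxz
  exact hy (r.trans hxz (r.symm hz))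

theorem isOpen_connectedComponent_of_finite {X : Type*} [TopologicalSpace X] {K : Set X}
    (hK : IsClopen K) (hfin : (connectedComponent '' K).Finite) {x : X} (hx : x ∈ K) :
    IsOpen (connectedComponent x) := by
  have h : connectedComponent x = K \ ⋃₀ (connectedComponent '' K \ {connectedComponent x}) := by
    ext y
    constructor
    · refine fun hy => ⟨hK.connectedComponent_subset hx hy, ?_⟩
      rintro ⟨_, ⟨⟨z, -, rfl⟩, hne⟩, hyz⟩
      exact hne ((connectedComponent_eq hyz).trans (connectedComponent_eq hy).symm)
    · rintro ⟨hyK, hy⟩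
      by_contra hne
      refine hy ⟨connectedComponent y, ⟨⟨y, hyK, rfl⟩, fun e => hne ?_⟩, mem_connectedComponent⟩
      rw [← mem_singleton_iff.1 e]
      exact mem_connectedComponent
  rw [h, sUnion_eq_biUnion]
  refine hK.isOpen.sdiff ((hfin.subset sdiff_subset).isClosed_biUnion ?_)
  rintro _ ⟨⟨z, -, rfl⟩, -⟩
  exact isClosed_connectedComponent

/-- The fibres of a locally constant map on a GO-space can be cut into convex clopen pieces each of
which is a component or meets infinitely many components. -/
theorem exists_setoid_isGood {ι : Type*} {F : X → ι} (hF : IsLocallyConstant F) :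
    ∃ r : Setoid X, (∀ x, IsOpen {y | r x y}) ∧ (∀ x, OrdConnected {y | r x y}) ∧
      (∀ x y, r x y → F y = F x) ∧ ∀ x, IsGood {y | r x y} := by
  set r₀ := intervalSetoid F
  set N : X → Set X := fun x => {y | r₀ x y}
  have hNeq : ∀ {x y}, r₀ x y → N x = N y := fun {x y} h => by
    ext z
    exact ⟨fun hz => r₀.trans (r₀.symm h) hz, fun hz => r₀.trans h hz⟩
  have hNc : ∀ x, IsClopen (N x) := isClopen_of_setoid r₀ (isOpen_intervalSetoid hF)
  let P : X → Prop := fun x => (connectedComponent '' N x).Infinite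
  let r : Setoid X :=
    { r := fun x y => r₀ x y ∧ (P x ∨ connectedComponent x = connectedComponent y)
      iseqv := by
        refine ⟨fun x => ⟨r₀.refl x, .inr rfl⟩, fun {x y} h => ⟨r₀.symm h.1, ?_⟩,
          fun {x y z} h h' => ⟨r₀.trans h.1 h'.1, ?_⟩⟩
        · exact h.2.imp (fun h' => by simpa only [P, hNeq h.1] using h') Eq.symm
        · rcases h.2 with hx | hx
          · exact .inl hx
          · refine h'.2.imp (fun h₂ => ?_) hx.trans
            simpa only [P, hNeq h.1] using h₂ }
  have hcases : ∀ x, (P x ∧ {y | r x y} = N x) ∨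
      (¬ P x ∧ {y | r x y} = connectedComponent x) := by
    intro x
    by_cases hP : P x
    · exact .inl ⟨hP, by ext y; exact ⟨fun h => h.1, fun h => ⟨h, .inl hP⟩⟩⟩
    · refine .inr ⟨hP, ?_⟩
      ext y
      constructor
      · rintro ⟨-, h⟩
        rw [h.resolve_left hP]
        exact mem_connectedComponent
      · exact fun h => ⟨(hNc x).connectedComponent_subset (r₀.refl x) h,
          .inr (connectedComponent_eq h)⟩
  refine ⟨r, fun x => ?_, fun x => ?_, fun x y h => h.1 y right_mem_uIcc, fun x => ?_⟩
  · rcases hcases x with ⟨-, h⟩ | ⟨hP, h⟩ <;> rw [h]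
    · exact (hNc x).isOpen
    · exact isOpen_connectedComponent_of_finite (hNc x) (not_infinite.1 hP) (r₀.refl x)
  · rcases hcases x with ⟨-, h⟩ | ⟨-, h⟩ <;> rw [h]
    · exact ordConnected_intervalSetoid F x
    · exact ordConnected_connectedComponent x
  · rcases hcases x with ⟨hP, h⟩ | ⟨-, h⟩ <;> rw [h]
    · exact .inr hP
    · exact .inl fun y hy z hz => (connectedComponent_eq hy).symm.trans (connectedComponent_eq hz)

/-- A set meeting infinitely many components has arbitrarily many points that are distinguished by
a locally constant map. -/
theorem exists_isLocallyConstant_injective {A : Set X} (hA : (connectedComponent '' A).Infinite)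
    (k : ℕ) : ∃ (g : X → Fin k × Fin k → Prop) (p : Fin k → X), IsLocallyConstant g ∧
      (∀ i, p i ∈ A) ∧ Function.Injective fun i => g (p i) := by
  let e := hA.natEmbedding
  choose p hp hpe using fun i : Fin k => (e i).2
  have hne : ∀ i j, i ≠ j → p j ∉ connectedComponent (p i) := fun i j hij h =>
    hij (Fin.ext (e.injective (Subtype.ext (by
      rw [← hpe i, ← hpe j, connectedComponent_eq h]))))
  have : ∀ q : Fin k × Fin k, ∃ D : Set X, IsClopen D ∧
      (q.1 ≠ q.2 → p q.1 ∈ D ∧ p q.2 ∉ D) := fun q => by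
    by_cases hq : q.1 = q.2
    · exact ⟨univ, isClopen_univ, fun h => (h hq).elim⟩
    · obtain ⟨D, hD, h⟩ := exists_isClopen_separating (hne _ _ hq)
      exact ⟨D, hD, fun _ => h⟩
  choose D hD hsep using this
  refine ⟨fun x q => x ∈ D q, p, ?_, hp, fun i j hij => ?_⟩
  · refine (IsLocallyConstant.iff_eventually_eq _).2 fun x => ?_
    have : ∀ q, ∀ᶠ y in 𝓝 x, (y ∈ D q ↔ x ∈ D q) := fun q => by
      by_cases hx : x ∈ D q
      · filter_upwards [(hD q).isOpen.mem_nhds hx] with y hy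
        exact iff_of_true hy hx
      · filter_upwards [(hD q).isClosed.isOpen_compl.mem_nhds hx] with y hy
        exact iff_of_false hy hx
    filter_upwards [Filter.eventually_all.2 this] with y hy
    exact funext fun q => propext (hy q)
  · by_contra hne
    have h := hsep (i, j) hne
    exact h.2 ((iff_of_eq (congrFun hij (i, j))).1 h.1)

end Partition

end GOSpace

section SetoidTournament

/-- `T` induces a recognizing tournament on the classes of `r` contained in `A`. -/
structure IsSetoidTournament {X : Type*} (r : Setoid X) (A : Set X) (T : X → X → Prop) : Prop where
  asymm : ∀ x ∈ A, ∀ y ∈ A, ¬ r x y → (T x y ↔ ¬ T y x)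
  congr : ∀ x x' y y', r x x' → r y y' → (T x y ↔ T x' y')
  separate : ∀ x ∈ A, ∃ F ⊆ A, F.Finite ∧ (∀ a ∈ F, ¬ r a x) ∧
    ∀ y ∈ A, ¬ r x y → ∃ a ∈ F, ¬ r a y ∧ ¬ (T a x ↔ T a y)
  dominate : ∃ D ⊆ A, D.Finite ∧ ∀ x ∈ A, ∃ a ∈ D, ¬ r a x ∧ T a x

theorem exists_isSetoidTournament {X : Type*} (r : Setoid X) {A : Set X}
    (hinv : ∀ x y, r x y → x ∈ A → y ∈ A)
    (hA : A = ∅ ∨ ∃ e : Fin 5 → X, (∀ i, e i ∈ A) ∧ ∀ i j, i ≠ j → ¬ r (e i) (e j)) :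
    ∃ T, IsSetoidTournament r A T := by
  let π : X → Quotient r := Quotient.mk r
  have hπ : ∀ {x y}, π x = π y ↔ r x y := fun {x y} => Quotient.eq
  have hout : ∀ q, π q.out = q := Quotient.out_eq
  have houtA : ∀ q ∈ π '' A, q.out ∈ A := by
    rintro _ ⟨x, hx, rfl⟩
    exact hinv x _ (hπ.1 (hout (π x)).symm) hx
  obtain ⟨T, hT⟩ := exists_isRecognizingTournament (π '' A) <| by
    refine hA.imp (fun h => by rw [h, image_empty]) ?_
    rintro ⟨e, he, hne⟩
    refine ⟨π ∘ e, fun i j hij => ?_, fun i => ⟨e i, he i, rfl⟩⟩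
    by_contra h
    exact hne i j h (hπ.1 hij)
  refine ⟨fun x y => T (π x) (π y), ?_, ?_, ?_, ?_⟩
  · exact fun x hx y hy h => hT.asymm _ ⟨x, hx, rfl⟩ _ ⟨y, hy, rfl⟩ (mt hπ.1 h)
  · intro x x' y y' hx hy
    rw [hπ.2 hx, hπ.2 hy]
  · intro x hx
    obtain ⟨F, hFA, hF, hxF, hsep⟩ := hT.separate (π x) ⟨x, hx, rfl⟩
    refine ⟨Quotient.out '' F, ?_, hF.image _, ?_, fun y hy hxy => ?_⟩
    · rintro _ ⟨q, hq, rfl⟩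
      exact houtA q (hFA hq)
    · rintro _ ⟨q, hq, rfl⟩ h
      rw [← hπ, hout] at h
      exact hxF (h ▸ hq)
    · obtain ⟨q, hq, hqy, h⟩ := hsep (π y) ⟨y, hy, rfl⟩ fun h => hxy (hπ.1 h.symm)
      refine ⟨_, ⟨q, hq, rfl⟩, ?_, ?_⟩
      · rwa [← hπ, hout]
      · rwa [hout]
  · obtain ⟨D, hDA, hD, hdom⟩ := hT.dominate
    refine ⟨Quotient.out '' D, ?_, hD.image _, fun x hx => ?_⟩
    · rintro _ ⟨q, hq, rfl⟩
      exact houtA q (hDA hq)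
    · obtain ⟨q, hq, hqx, h⟩ := hdom (π x) ⟨x, hx, rfl⟩
      refine ⟨_, ⟨q, hq, rfl⟩, ?_, ?_⟩
      · rwa [← hπ, hout]
      · rwa [hout]

/-- `L` induces on the classes of `r` contained in `K` a tournament in which every class is
recognised by its relation to finitely many other classes. -/
structure IsRecognizing {X : Type*} (r : Setoid X) (K : Set X) (L : X → X → Prop) : Prop where
  asymm : ∀ x ∈ K, ∀ y ∈ K, ¬ r x y → (L x y ↔ ¬ L y x)
  congr : ∀ x x' y y', r x x' → r y y' → (L x y ↔ L x' y')
  separate : ∀ x ∈ K, ∃ F ⊆ K, F.Finite ∧ (∀ a ∈ F, ¬ r a x) ∧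
    ∀ y ∈ K, ¬ r x y → ∃ a ∈ F, ¬ r a y ∧ ¬ (L a x ↔ L a y)

/-- Put a tournament on `A` above, and a reversed tournament on `B` below, the class of `c`. -/
theorem exists_isRecognizing {X : Type*} {r : Setoid X} {A B K : Set X} {c : X}
    (hAinv : ∀ x y, r x y → x ∈ A → y ∈ A) (hBinv : ∀ x y, r x y → x ∈ B → y ∈ B)
    (hK : ∀ x, x ∈ K ↔ x ∈ A ∨ x ∈ B ∨ r c x) (hAB : ∀ x ∈ A, x ∉ B)
    (hcA : c ∉ A) (hcB : c ∉ B)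
    (hA : A = ∅ ∨ ∃ e : Fin 5 → X, (∀ i, e i ∈ A) ∧ ∀ i j, i ≠ j → ¬ r (e i) (e j))
    (hB : B = ∅ ∨ ∃ e : Fin 5 → X, (∀ i, e i ∈ B) ∧ ∀ i j, i ≠ j → ¬ r (e i) (e j)) :
    ∃ L, IsRecognizing r K L ∧ (∀ x ∈ B, ∀ y ∉ B, L x y) ∧ ∀ x ∉ A, ∀ y ∈ A, L x y := by
  obtain ⟨S, hS⟩ := exists_isSetoidTournament r hAinv hA
  obtain ⟨T, hT⟩ := exists_isSetoidTournament r hBinv hB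
  have hA' : ∀ {x y}, r x y → (x ∈ A ↔ y ∈ A) := fun h => ⟨hAinv _ _ h, hAinv _ _ (r.symm h)⟩
  have hB' : ∀ {x y}, r x y → (x ∈ B ↔ y ∈ B) := fun h => ⟨hBinv _ _ h, hBinv _ _ (r.symm h)⟩
  have hcA' : ∀ {x}, r c x → x ∉ A := fun h hx => hcA ((hA' h).2 hx)
  have hcB' : ∀ {x}, r c x → x ∉ B := fun h hx => hcB ((hB' h).2 hx)
  let L : X → X → Prop := fun x y =>
    (x ∈ B ∧ y ∉ B) ∨ (x ∉ A ∧ y ∈ A) ∨ (x ∈ A ∧ y ∈ A ∧ S x y) ∨ (x ∈ B ∧ y ∈ B ∧ T y x)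
  have hLA : ∀ {x y}, x ∈ A → y ∈ A → (L x y ↔ S x y) := fun {x y} hx hy => by
    simp [L, hx, hy, hAB x hx]
  have hLB : ∀ {x y}, x ∈ B → y ∈ B → (L x y ↔ T y x) := fun {x y} hx hy => by
    simp [L, hx, hy, show y ∉ A from fun h => hAB y h hy]
  have hL₁ : ∀ {x y}, x ∈ B → y ∉ B → L x y := fun hx hy => .inl ⟨hx, hy⟩
  have hL₂ : ∀ {x y}, x ∉ A → y ∈ A → L x y := fun hx hy => .inr (.inl ⟨hx, hy⟩)
  have hL₃ : ∀ {x y}, x ∉ B → y ∈ B → ¬ L x y := fun {x y} hx hy => by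
    simp [L, hx, hy, show y ∉ A from fun h => hAB y h hy]
  have hL₄ : ∀ {x y}, x ∈ A → y ∉ A → ¬ L x y := fun {x y} hx hy => by
    simp [L, hx, hy, hAB x hx]
  refine ⟨L, ⟨fun x hx y hy hxy => ?_, fun x x' y y' hx hy => ?_, fun x hx => ?_⟩,
    fun x hx y hy => hL₁ hx hy, fun x hx y hy => hL₂ hx hy⟩
  · by_cases hxA : x ∈ A <;> by_cases hyA : y ∈ A
    · rw [hLA hxA hyA, hLA hyA hxA]
      exact hS.asymm x hxA y hyA hxy
    · exact iff_of_false (hL₄ hxA hyA) (not_not.2 (hL₂ hyA hxA))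
    · exact iff_of_true (hL₂ hxA hyA) (hL₄ hyA hxA)
    by_cases hxB : x ∈ B <;> by_cases hyB : y ∈ B
    · rw [hLB hxB hyB, hLB hyB hxB]
      exact hT.asymm y hyB x hxB fun h => hxy (r.symm h)
    · exact iff_of_true (hL₁ hxB hyB) (hL₃ hyB hxB)
    · exact iff_of_false (hL₃ hxB hyB) (not_not.2 (hL₁ hyB hxB))
    · have hx' := (((hK x).1 hx).resolve_left hxA).resolve_left hxB
      have hy' := (((hK y).1 hy).resolve_left hyA).resolve_left hyB
      exact (hxy (r.trans (r.symm hx') hy')).elim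
  · simp only [L, hA' hx, hA' hy, hB' hx, hB' hy, hS.congr x x' y y' hx hy,
      hT.congr y y' x x' hy hx]
  obtain ⟨D, hDA, hD, hDdom⟩ := hS.dominate
  obtain ⟨E, hEB, hE, hEdom⟩ := hT.dominate
  have hAK : A ⊆ K := fun y hy => (hK y).2 (.inl hy)
  have hBK : B ⊆ K := fun y hy => (hK y).2 (.inr (.inl hy))
  have hcK : c ∈ K := (hK c).2 (.inr (.inr (r.refl c)))
  rcases (hK x).1 hx with hxA | hxB | hxc
  · obtain ⟨F, hFA, hF, hxF, hsep⟩ := hS.separate x hxA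
    refine ⟨F ∪ {a ∈ D | ¬ r a x} ∪ {c}, ?_, (hF.union (hD.subset (sep_subset _ _))).union
      (finite_singleton c), ?_, fun y hy hxy => ?_⟩
    · refine union_subset (union_subset (hFA.trans hAK) fun a ha => hAK (hDA ha.1)) ?_
      exact singleton_subset_iff.2 hcK
    · rintro a ((ha | ha) | rfl)
      · exact hxF a ha
      · exact ha.2
      · exact fun h => hcA' h hxA
    · rcases (hK y).1 hy with hyA | hyB | hyc
      · obtain ⟨a, ha, hay, h⟩ := hsep y hyA hxy
        refine ⟨a, .inl (.inl ha), hay, ?_⟩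
        rwa [hLA (hFA ha) hxA, hLA (hFA ha) hyA]
      · exact ⟨c, .inr rfl, fun h => hcB' h hyB, fun h => hL₃ hcB hyB (h.1 (hL₂ hcA hxA))⟩
      · obtain ⟨a, ha, hax, h⟩ := hDdom x hxA
        refine ⟨a, .inl (.inr ⟨ha, hax⟩), fun h => hcA' hyc ((hA' h).1 (hDA ha)), fun h' => ?_⟩
        exact hL₄ (hDA ha) (hcA' hyc) (h'.1 ((hLA (hDA ha) hxA).2 h))
  · obtain ⟨F, hFB, hF, hxF, hsep⟩ := hT.separate x hxB
    refine ⟨F ∪ {a ∈ E | ¬ r a x} ∪ {c}, ?_, (hF.union (hE.subset (sep_subset _ _))).union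
      (finite_singleton c), ?_, fun y hy hxy => ?_⟩
    · refine union_subset (union_subset (hFB.trans hBK) fun a ha => hBK (hEB ha.1)) ?_
      exact singleton_subset_iff.2 hcK
    · rintro a ((ha | ha) | rfl)
      · exact hxF a ha
      · exact ha.2
      · exact fun h => hcB' h hxB
    · rcases (hK y).1 hy with hyA | hyB | hyc
      · exact ⟨c, .inr rfl, fun h => hcA' h hyA, fun h => hL₃ hcB hxB (h.2 (hL₂ hcA hyA))⟩
      · obtain ⟨a, ha, hay, h⟩ := hsep y hyB hxy
        refine ⟨a, .inl (.inl ha), hay, ?_⟩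
        have h₁ := hT.asymm x hxB a (hFB ha) fun h => hxF a ha (r.symm h)
        have h₂ := hT.asymm y hyB a (hFB ha) fun h => hay (r.symm h)
        rw [hLB (hFB ha) hxB, hLB (hFB ha) hyB]
        tauto
      · obtain ⟨a, ha, hax, h⟩ := hEdom x hxB
        refine ⟨a, .inl (.inr ⟨ha, hax⟩), fun h => hcB' hyc ((hB' h).1 (hEB ha)), fun h' => ?_⟩
        have h₁ := (hLB (hEB ha) hxB).1 (h'.2 (hL₁ (hEB ha) (hcB' hyc)))
        exact (hT.asymm a (hEB ha) x hxB hax).1 h h₁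
  · refine ⟨D ∪ E, union_subset (hDA.trans hAK) (hEB.trans hBK), hD.union hE, ?_,
      fun y hy hxy => ?_⟩
    · rintro a (ha | ha) h
      · exact hcA' hxc ((hA' h).1 (hDA ha))
      · exact hcB' hxc ((hB' h).1 (hEB ha))
    · rcases (hK y).1 hy with hyA | hyB | hyc
      · obtain ⟨a, ha, hay, h⟩ := hDdom y hyA
        refine ⟨a, .inl ha, hay, fun h' => ?_⟩
        exact hL₄ (hDA ha) (hcA' hxc) (h'.2 ((hLA (hDA ha) hyA).2 h))
      · obtain ⟨a, ha, hay, h⟩ := hEdom y hyB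
        refine ⟨a, .inr ha, hay, fun h' => ?_⟩
        have h₁ := (hLB (hEB ha) hyB).1 (h'.1 (hL₁ (hEB ha) (hcB' hxc)))
        exact (hT.asymm a (hEB ha) y hyB hay).1 h h₁
      · exact (hxy (r.trans (r.symm hxc) hyc)).elim

end SetoidTournament

namespace GOSpace

section Refinement

variable {X : Type*} [TopologicalSpace X] [LinearOrder X] [GOSpace X]

theorem infinite_image_inter_above {c : X} {K : Set X} (h : ¬ IsClosed (above c))
    (hK : IsClopen K) (hc : c ∈ K) : (connectedComponent '' (K ∩ above c)).Infinite := by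
  intro hfin
  obtain ⟨M, hM, hMcl⟩ := exists_isGreatest_of_not_isClosed_above h
  have hcl : IsClosed (⋃ C ∈ connectedComponent '' (K ∩ above c), C) := by
    refine hfin.isClosed_biUnion ?_
    rintro _ ⟨z, -, rfl⟩
    exact isClosed_connectedComponent
  have hMU : M ∈ K \ ⋃ C ∈ connectedComponent '' (K ∩ above c), C := by
    refine ⟨hK.connectedComponent_subset hc hM.1, fun hmem => ?_⟩
    simp only [mem_iUnion, mem_image, exists_prop] at hmem
    obtain ⟨_, ⟨z, hz, rfl⟩, hMz⟩ := hmem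
    refine notMem_of_mem_above hz.2 ?_
    rw [connectedComponent_eq hM.1, ← connectedComponent_eq hMz]
    exact mem_connectedComponent
  obtain ⟨y, ⟨hyK, hy⟩, hya⟩ := mem_closure_iff.1 hMcl _ (hK.isOpen.sdiff hcl) hMU
  exact hy (mem_biUnion ⟨y, ⟨hyK, hya⟩, rfl⟩ mem_connectedComponent)

theorem infinite_image_inter_below {c : X} {K : Set X} (h : ¬ IsClosed (below c))
    (hK : IsClopen K) (hc : c ∈ K) : (connectedComponent '' (K ∩ below c)).Infinite :=
  infinite_image_inter_above (X := Xᵒᵈ) h hK hc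

/-- A set with no components or infinitely many components is split into no or at least five
pieces, one class being ignored, by any equivalence relation compatible with a suitable locally
constant map. -/
theorem exists_isLocallyConstant_forall_setoid {R : Set X}
    (hR : R = ∅ ∨ (connectedComponent '' R).Infinite) :
    ∃ g : X → Fin 6 × Fin 6 → Prop, IsLocallyConstant g ∧
      ∀ (r : Setoid X) (c : X), (∀ x y, r x y → g y = g x) → {y ∈ R | ¬ r c y} = ∅ ∨
        ∃ e : Fin 5 → X, (∀ i, e i ∈ {y ∈ R | ¬ r c y}) ∧ ∀ i j, i ≠ j → ¬ r (e i) (e j) := by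
  rcases hR with rfl | hR
  · exact ⟨fun _ _ => True, .const _, fun _ _ _ => .inl (by simp)⟩
  obtain ⟨g, p, hg, hpR, hinj⟩ := exists_isLocallyConstant_injective hR 6
  refine ⟨g, hg, fun r c hr => .inr ?_⟩
  obtain ⟨k, hk⟩ : ∃ k, ∀ i, i ≠ k → ¬ r c (p i) := by
    by_cases h : ∃ k, r c (p k)
    · obtain ⟨k, hk⟩ := h
      exact ⟨k, fun i hi hci => hi (hinj (hr _ _ (r.trans (r.symm hk) hci)))⟩
    · exact ⟨0, fun i _ hi => h ⟨i, hi⟩⟩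
  refine ⟨fun i => p (k.succAbove i), fun i => ⟨hpR _, hk _ (k.succAbove_ne i)⟩,
    fun i j hij h => hij ?_⟩
  exact (Fin.succAbove_right_injective (hinj (hr _ _ h))).symm

/-- A good clopen set can be partitioned into convex clopen good sets, with a recognizing
tournament on the parts that is compatible with the order around the component of `c`. -/
theorem exists_setoid_isRecognizing {ι : Type*} {f : X → ι} (hf : IsLocallyConstant f)
    {K : Set X} (hK : IsClopen K) (hgood : IsGood K) {c : X} (hc : c ∈ K) :
    ∃ (r : Setoid X) (L : X → X → Prop), (∀ x, IsOpen {y | r x y}) ∧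
      (∀ x, OrdConnected {y | r x y}) ∧ (∀ x, IsGood {y | r x y}) ∧
      (∀ x y, r x y → f y = f x) ∧ (∀ x y, r x y → x ∈ K → y ∈ K) ∧ IsRecognizing r K L ∧
      ∀ p ∈ K, ∀ q ∈ K, ∀ d ∈ connectedComponent c, ¬ r p q → p ≤ d → d ≤ q →
        (p ∈ connectedComponent c ∨ ¬ IsClosed (below c)) →
        (q ∈ connectedComponent c ∨ ¬ IsClosed (above c)) → L p q := by
  set P : X → Prop := fun y => ¬ IsClosed (below c) → ¬ IsClosed (above c) ∧ c < y
  have hR : {y ∈ K | y ∉ connectedComponent c ∧ P y} = ∅ ∨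
      (connectedComponent '' {y ∈ K | y ∉ connectedComponent c ∧ P y}).Infinite := by
    by_cases hb : IsClosed (below c)
    · have hPt : ∀ y, P y := fun y h => (h hb).elim
      rcases hgood with h | h
      · refine .inl (eq_empty_of_forall_notMem fun y hy => hy.2.1 ?_)
        rw [h c hc y hy.1]
        exact mem_connectedComponent
      · refine .inr fun hfin => h ((hfin.insert (connectedComponent c)).subset ?_)
        rintro _ ⟨y, hy, rfl⟩
        by_cases hyc : y ∈ connectedComponent c
        · exact .inl (connectedComponent_eq hyc).symm
        · exact .inr ⟨y, ⟨hy, hyc, hPt y⟩, rfl⟩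
    · by_cases ha : IsClosed (above c)
      · exact .inl (eq_empty_of_forall_notMem fun y hy => (hy.2.2 hb).1 ha)
      · refine .inr ((infinite_image_inter_above ha hK hc).mono (image_mono ?_))
        exact fun y hy => ⟨hy.1, notMem_of_mem_above hy.2,
          fun _ => ⟨ha, hy.2 c mem_connectedComponent⟩⟩
  have hS : {y ∈ K | y ∉ connectedComponent c ∧ ¬ P y} = ∅ ∨
      (connectedComponent '' {y ∈ K | y ∉ connectedComponent c ∧ ¬ P y}).Infinite := by
    by_cases hb : IsClosed (below c)
    · exact .inl (eq_empty_of_forall_notMem fun y hy => hy.2.2 fun h => (h hb).elim)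
    · refine .inr ((infinite_image_inter_below hb hK hc).mono (image_mono ?_))
      exact fun y hy => ⟨hy.1, notMem_of_mem_below hy.2,
        fun h => (h hb).2.not_gt (hy.2 c mem_connectedComponent)⟩
  obtain ⟨g, hg, hgr⟩ := exists_isLocallyConstant_forall_setoid hR
  obtain ⟨h, hh, hhr⟩ := exists_isLocallyConstant_forall_setoid hS
  have hχ : IsLocallyConstant fun y => y ∈ K := by
    refine (IsLocallyConstant.iff_eventually_eq _).2 fun x => ?_
    by_cases hx : x ∈ K
    · filter_upwards [hK.isOpen.mem_nhds hx] with y hy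
      exact propext (iff_of_true hy hx)
    · filter_upwards [hK.isClosed.isOpen_compl.mem_nhds hx] with y hy
      exact propext (iff_of_false hy hx)
  obtain ⟨r, hopen, hconv, hF, hgd⟩ :=
    exists_setoid_isGood (hf.prodMk (hχ.prodMk (hg.prodMk hh)))
  simp only [Prod.mk.injEq] at hF
  have hrK : ∀ x y, r x y → x ∈ K → y ∈ K := fun x y hxy hx => (hF x y hxy).2.1 ▸ hx
  have hcomp : ∀ y, y ∈ connectedComponent c → r c y := fun y hy =>
    (isClopen_of_setoid r hopen c).connectedComponent_subset (r.refl c) hy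
  have hlt : ∀ x y, r x y → ¬ r c x → c < x → c < y := fun x y hxy hcx hx => by
    by_contra hy
    exact hcx (r.symm ((hconv x).out hxy (r.refl x) ⟨not_lt.1 hy, hx.le⟩))
  have hPinv : ∀ x y, r x y → ¬ r c x → P x → P y := fun x y hxy hcx hx hb =>
    ⟨(hx hb).1, hlt x y hxy hcx (hx hb).2⟩
  have hcinv : ∀ x y, r x y → ¬ r c x → ¬ r c y := fun x y hxy hcx hcy =>
    hcx (r.trans hcy (r.symm hxy))
  have hsimp : ∀ Q : X → Prop, {y ∈ {y ∈ K | y ∉ connectedComponent c ∧ Q y} | ¬ r c y} =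
      {y ∈ K | ¬ r c y ∧ Q y} := fun Q => by
    ext y
    exact ⟨fun hy => ⟨hy.1.1, hy.2, hy.1.2.2⟩,
      fun hy => ⟨⟨hy.1, fun h => hy.2.1 (hcomp y h), hy.2.2⟩, hy.2.1⟩⟩
  have hA := hgr r c fun x y hxy => (hF x y hxy).2.2.1
  have hB := hhr r c fun x y hxy => (hF x y hxy).2.2.2
  rw [hsimp] at hA hB
  obtain ⟨L, hL, hLB, hLA⟩ := exists_isRecognizing (r := r) (K := K) (c := c)
    (A := {y ∈ K | ¬ r c y ∧ P y}) (B := {y ∈ K | ¬ r c y ∧ ¬ P y})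
    (fun x y hxy hx => ⟨hrK x y hxy hx.1, hcinv x y hxy hx.2.1, hPinv x y hxy hx.2.1 hx.2.2⟩)
    (fun x y hxy hx => ⟨hrK x y hxy hx.1, hcinv x y hxy hx.2.1, fun hy =>
      hx.2.2 (hPinv y x (r.symm hxy) (hcinv x y hxy hx.2.1) hy)⟩)
    (fun x => ⟨fun hx => by simp only [mem_ofPred_eq]; tauto, by
      rintro (hx | hx | hx)
      · exact hx.1
      · exact hx.1
      · exact hrK c x hx hc⟩)
    (fun x hx hx' => hx'.2.2 hx.2.2) (fun h => h.2.1 (r.refl c)) (fun h => h.2.1 (r.refl c)) hA hB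
  refine ⟨r, L, hopen, hconv, hgd, fun x y hxy => (hF x y hxy).1, hrK, hL, ?_⟩
  intro p hp q hq d hd hpq hpd hdq hpb hqa
  have hplt : p ∉ connectedComponent c → ¬ c < p := fun hpc =>
    (mem_below_of_lt hd hpd hpc c mem_connectedComponent).not_gt
  by_cases hcq : r c q
  · have hcp : ¬ r c p := fun hcp => hpq (r.trans (r.symm hcp) hcq)
    have hpc : p ∉ connectedComponent c := fun h => hcp (hcomp p h)
    exact hLB p ⟨hp, hcp, fun h => hplt hpc (h (hpb.resolve_left hpc)).2⟩ q fun h => h.2.1 hcq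
  · have hqc : q ∉ connectedComponent c := fun h => hcq (hcomp q h)
    refine hLA p (fun h => ?_) q ⟨hq, hcq, fun _ => ⟨hqa.resolve_left hqc,
      mem_above_of_lt hd hdq hqc c mem_connectedComponent⟩⟩
    have hpc : p ∉ connectedComponent c := fun h' => h.2.1 (hcomp p h')
    exact hplt hpc (h.2.2 (hpb.resolve_left hpc)).2

end Refinement

section Sequence

variable {X : Type*} [TopologicalSpace X] [LinearOrder X]

/-- An equivalence relation with convex open good classes. -/
structure IsGoodSetoid (s : Setoid X) : Prop where
  isOpen : ∀ x, IsOpen {y | s x y}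
  ordConnected : ∀ x, OrdConnected {y | s x y}
  isGood : ∀ x, IsGood {y | s x y}

/-- `t` refines `s`, and `L` induces, in each class of `s`, a recognizing tournament on the classes
of `t` that is compatible with the order around the component of the base point `b x`. -/
structure IsRefinement (s t : Setoid X) (L : X → X → Prop) (b : X → X) : Prop where
  le : t ≤ s
  asymm : ∀ x y, s x y → ¬ t x y → (L x y ↔ ¬ L y x)
  congr : ∀ x x' y y', s x y → t x x' → t y y' → (L x y ↔ L x' y')
  separate : ∀ x, ∃ F : Set X, F.Finite ∧ (∀ a ∈ F, s x a ∧ ¬ t a x) ∧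
    ∀ y, s x y → ¬ t x y → ∃ a ∈ F, ¬ t a y ∧ ¬ (L a x ↔ L a y)
  compat : ∀ p q, s p q → ¬ t p q → ∀ d ∈ connectedComponent (b p), p ≤ d → d ≤ q →
    (p ∈ connectedComponent (b p) ∨ ¬ IsClosed (below (b p))) →
    (q ∈ connectedComponent (b p) ∨ ¬ IsClosed (above (b p))) → L p q

variable [GOSpace X]

theorem IsGoodSetoid.exists_isRefinement {ι : Type*} {f : X → ι} (hf : IsLocallyConstant f)
    {s : Setoid X} (hs : IsGoodSetoid s) {b : X → X} (hb : ∀ x, s x (b x))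
    (hb' : ∀ x y, s x y → b x = b y) :
    ∃ (t : Setoid X) (L : X → X → Prop), IsGoodSetoid t ∧ (∀ x y, t x y → f y = f x) ∧
      IsRefinement s t L b := by
  choose r L hopen hconv hgood hrf hrK hL hcompat using fun c =>
    exists_setoid_isRecognizing hf (isClopen_of_setoid s hs.isOpen c) (hs.isGood c) (s.refl c)
  have hbK : ∀ x, x ∈ {y | s (b x) y} := fun x => s.symm (hb x)
  have hrs : ∀ {x y}, r (b x) x y → s x y := fun {x y} h =>
    s.trans (hb x) (hrK (b x) x y h (hbK x))
  have hbs : ∀ {x y}, s x y → y ∈ {y | s (b x) y} := fun {x y} h => s.trans (hbK x) h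
  let t : Setoid X :=
    { r := fun x y => r (b x) x y
      iseqv := by
        refine ⟨fun x => (r (b x)).refl x, fun {x y} h => ?_, fun {x y z} h h' => ?_⟩
        · exact hb' x y (hrs h) ▸ (r (b x)).symm h
        · exact (r (b x)).trans h ((hb' x y (hrs h)).symm ▸ h') }
  refine ⟨t, fun x y => L (b x) x y, ⟨fun x => hopen (b x) x, fun x => hconv (b x) x,
    fun x => hgood (b x) x⟩, fun x y h => hrf (b x) x y h, fun {x y} h => hrs h, ?_, ?_, ?_, ?_⟩
  · intro x y hxy h
    rw [← hb' x y hxy]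
    exact (hL (b x)).asymm x (hbK x) y (hbs hxy) h
  · intro x x' y y' hxy hx hy
    rw [← hb' x x' (hrs hx)]
    exact (hL (b x)).congr x x' y y' hx ((hb' x y hxy).symm ▸ hy)
  · intro x
    obtain ⟨F, hFK, hF, hFx, hsep⟩ := (hL (b x)).separate x (hbK x)
    have hbF : ∀ {a}, a ∈ F → b a = b x := fun ha => (hb' x _ (s.trans (hb x) (hFK ha))).symm
    refine ⟨F, hF, fun a ha => ⟨s.trans (hb x) (hFK ha), fun h => hFx a ha (hbF ha ▸ h)⟩,
      fun y hxy hty => ?_⟩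
    obtain ⟨a, ha, hay, h⟩ := hsep y (hbs hxy) hty
    exact ⟨a, ha, fun h' => hay (hbF ha ▸ h'), by simpa only [hbF ha] using h⟩
  · intro p q hpq htpq d hd
    exact hcompat (b p) p (hbK p) q (hbs hpq) d hd htpq

/-- There is a sequence of successive refinements prescribed by locally constant maps, with base
points enjoying given properties whenever possible. -/
theorem exists_seq_isRefinement {ι : Type*} {f : ℕ → X → ι} (hf : ∀ n, IsLocallyConstant (f n))
    (P : ℕ → X → Prop) (hinf : (range fun x : X => connectedComponent x).Infinite) :
    ∃ (s : ℕ → Setoid X) (L : ℕ → X → X → Prop) (b : ℕ → X → X), s 0 = ⊤ ∧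
      (∀ n, IsGoodSetoid (s n)) ∧ (∀ n x y, s (n + 1) x y → f n y = f n x) ∧
      (∀ n, IsRefinement (s n) (s (n + 1)) (L n) (b n)) ∧ (∀ n x, s n x (b n x)) ∧
      ∀ n x y, s n x y → P n y → P n (b n x) := by
  have hstep : ∀ (n : ℕ) (s : {s : Setoid X // IsGoodSetoid s}),
      ∃ (t : {s : Setoid X // IsGoodSetoid s}) (L : X → X → Prop) (b : X → X),
        (∀ x y, t.1 x y → f n y = f n x) ∧ IsRefinement s.1 t.1 L b ∧ (∀ x, s.1 x (b x)) ∧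
        ∀ x y, s.1 x y → P n y → P n (b x) := by
    rintro n ⟨s, hs⟩
    have hβ : ∀ K : Set X, ∃ q, K.Nonempty → q ∈ K ∧ ∀ x ∈ K, P n x → P n q := by
      intro K
      by_cases h : ∃ x ∈ K, P n x
      · obtain ⟨q, hq, hPq⟩ := h
        exact ⟨q, fun _ => ⟨hq, fun _ _ _ => hPq⟩⟩
      · by_cases hK : K.Nonempty
        · exact ⟨hK.some, fun _ => ⟨hK.some_mem, fun x hx hPx => (h ⟨x, hx, hPx⟩).elim⟩⟩
        · obtain ⟨_, x, -⟩ := hinf.nonempty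
          exact ⟨x, fun h => (hK h).elim⟩
    choose β hβ using hβ
    have hβ' := fun x => hβ {y | s x y} ⟨x, s.refl x⟩
    obtain ⟨t, L, ht, hft, href⟩ := hs.exists_isRefinement (hf n) (b := fun x => β {y | s x y})
      (fun x => (hβ' x).1) fun x y hxy => congrArg β <| by
        ext z
        exact ⟨fun h => s.trans (s.symm hxy) h, fun h => s.trans hxy h⟩
    exact ⟨⟨t, ht⟩, L, _, hft, href, fun x => (hβ' x).1, fun x => (hβ' x).2⟩
  choose t L b hft href hb hP using hstep
  have htop : IsGoodSetoid (⊤ : Setoid X) := by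
    have : ∀ x : X, {y | (⊤ : Setoid X) x y} = univ := fun x => eq_univ_of_forall fun y => trivial
    refine ⟨fun x => ?_, fun x => ?_, fun x => ?_⟩ <;> rw [this]
    · exact isOpen_univ
    · exact ordConnected_univ
    · exact .inr (by rwa [image_univ])
  let S : ℕ → {s : Setoid X // IsGoodSetoid s} := fun n => Nat.rec ⟨⊤, htop⟩ t n
  exact ⟨fun n => (S n).1, fun n => L n (S n), fun n => b n (S n), rfl, fun n => (S n).2,
    fun n => hft n (S n), fun n => href n (S n), fun n => hb n (S n), fun n => hP n (S n)⟩

end Sequence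

section Shrink

variable {X : Type*} [MetricSpace X] [LinearOrder X] [GOSpace X]

theorem exists_forall_le_mem_of_isSmallNhd {x : X} {K : ℕ → Set X} (hx : ∀ n, x ∈ K n)
    (hconv : ∀ n, (K n).OrdConnected)
    (hK : ∀ n : ℕ, ∃ w W, IsSmallNhd (1 / ((n : ℝ) + 1)) w W ∧ K n ⊆ W)
    {O : Set X} (hO : IsOpen O) (hxO : connectedComponent x ⊆ O) :
    ∃ N, ∀ n ≥ N, ∀ y ∈ K n, x ≤ y → y ∈ O := by
  have hsmall : ∀ ε > 0, ∃ N : ℕ, ∀ n ≥ N, ∃ w W, IsSmallNhd ε w W ∧ K n ⊆ W := by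
    intro ε hε
    obtain ⟨N, hN⟩ := exists_nat_one_div_lt hε
    refine ⟨N, fun n hn => ?_⟩
    obtain ⟨w, W, hW, hKW⟩ := hK n
    exact ⟨w, W, hW.mono ((Nat.one_div_le_one_div hn).trans hN.le), hKW⟩
  by_cases hcl : IsClosed (above x)
  · obtain ⟨ε, hε, h⟩ := exists_forall_isSmallNhd_notMem_above hcl
    obtain ⟨N, hN⟩ := hsmall ε hε
    refine ⟨N, fun n hn y hy hxy => ?_⟩
    obtain ⟨w, W, hW, hKW⟩ := hN n hn
    by_contra hyO
    exact h w W hW (hKW (hx n)) y (hKW hy)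
      (mem_above_of_lt mem_connectedComponent hxy fun h => hyO (hxO h))
  · obtain ⟨M, hM, hMcl⟩ := exists_isGreatest_of_not_isClosed_above hcl
    obtain ⟨V, hV, hMV, hVO, hVc⟩ := exists_ordConnected M O hO (hxO hM.1)
    obtain ⟨z, hzV, hz⟩ := mem_closure_iff.1 hMcl V hV hMV
    obtain ⟨ε, hε, h⟩ := exists_forall_isSmallNhd_notMem (hz x mem_connectedComponent)
      (notMem_of_mem_above hz)
    obtain ⟨N, hN⟩ := hsmall ε hε
    refine ⟨N, fun n hn y hy hxy => ?_⟩
    obtain ⟨w, W, hW, hKW⟩ := hN n hn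
    have hyz : y < z := lt_of_not_ge fun hzy => h w W hW (hKW (hx n))
      (hKW ((hconv n).out (hx n) hy ⟨(hz x mem_connectedComponent).le, hzy⟩))
    by_cases hyx : y ∈ connectedComponent x
    · exact hxO hyx
    · have hya := mem_above_of_lt mem_connectedComponent hxy hyx
      exact hVO (hVc.out hMV hzV ⟨(hya M hM.1).le, hyz.le⟩)

theorem exists_subset_of_isSmallNhd {x : X} {K : ℕ → Set X} (hx : ∀ n, x ∈ K n)
    (hconv : ∀ n, (K n).OrdConnected)
    (hK : ∀ n : ℕ, ∃ w W, IsSmallNhd (1 / ((n : ℝ) + 1)) w W ∧ K n ⊆ W)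
    {O : Set X} (hO : IsOpen O) (hxO : connectedComponent x ⊆ O) : ∃ n, K n ⊆ O := by
  obtain ⟨N, hN⟩ := exists_forall_le_mem_of_isSmallNhd hx hconv hK hO hxO
  have : @GOSpace Xᵒᵈ PseudoMetricSpace.toUniformSpace.toTopologicalSpace _ :=
    instOrderDual (X := X)
  obtain ⟨N', hN'⟩ := exists_forall_le_mem_of_isSmallNhd (X := Xᵒᵈ) (x := x) (K := K) hx
    (fun n => (hconv n).dual) (fun n => by
      obtain ⟨w, W, hW, h⟩ := hK n
      exact ⟨w, W, hW.dual, h⟩) hO hxO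
  refine ⟨max N N', fun y hy => ?_⟩
  rcases le_total x y with h | h
  · exact hN _ (le_max_left _ _) y hy h
  · exact hN' _ (le_max_right _ _) y hy h

/-- A sequence of successively finer partitions, with relations inducing recognizing tournaments
on the children of each node. -/
structure IsTournamentTree {X : Type*} (s : ℕ → Setoid X) (L : ℕ → X → X → Prop) : Prop where
  zero : s 0 = ⊤
  le : ∀ n, s (n + 1) ≤ s n
  asymm : ∀ n x y, s n x y → ¬ s (n + 1) x y → (L n x y ↔ ¬ L n y x)
  congr : ∀ n x x' y y', s n x y → s (n + 1) x x' → s (n + 1) y y' → (L n x y ↔ L n x' y')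
  separate : ∀ n x, ∃ F : Set X, F.Finite ∧ (∀ a ∈ F, s n x a ∧ ¬ s (n + 1) a x) ∧
    ∀ y, s n x y → ¬ s (n + 1) x y → ∃ a ∈ F, ¬ s (n + 1) a y ∧ ¬ (L n a x ↔ L n a y)

/-- A tournament tree of convex open sets shrinking to the components of the space and compatible
with the order around each nondegenerate component. -/
structure IsSelectionTree {X : Type*} [TopologicalSpace X] [LinearOrder X] (s : ℕ → Setoid X)
    (L : ℕ → X → X → Prop) : Prop extends IsTournamentTree s L where
  isOpen : ∀ n x, IsOpen {y | s n x y}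
  ordConnected : ∀ n x, OrdConnected {y | s n x y}
  shrink : ∀ x O, IsOpen O → connectedComponent x ⊆ O → ∃ n, {y | s n x y} ⊆ O
  compat : ∀ x, (connectedComponent x).Nontrivial → ∃ N, ∀ n ≥ N, ∀ p q, s n x p → s n x q →
    ¬ s (n + 1) p q → ∀ d ∈ connectedComponent x, p ≤ d → d ≤ q →
    (p ∈ connectedComponent x ∨ ¬ IsClosed (below x)) →
    (q ∈ connectedComponent x ∨ ¬ IsClosed (above x)) → L n p q

theorem exists_isSelectionTree (hinf : (range fun x : X => connectedComponent x).Infinite) :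
    ∃ (s : ℕ → Setoid X) (L : ℕ → X → X → Prop), IsSelectionTree s L := by
  have hpos : ∀ n : ℕ, (0 : ℝ) < 1 / ((n : ℝ) + 1) := fun n => Nat.one_div_pos_of_nat
  choose W hxW hW using fun n : ℕ => fun x : X => exists_isSmallNhd (hpos n) x
  choose f hf hxf using fun n : ℕ =>
    exists_isLocallyConstant_mem (W n) (fun x => (hW n x).isClopen) (hxW n)
  let P : ℕ → X → Prop := fun n x => ∃ u ∈ connectedComponent x, ∃ v ∈ connectedComponent x,
    2 * (1 / (((n - 1 : ℕ) : ℝ) + 1)) ≤ dist u v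
  obtain ⟨s, L, b, h0, hgood, hsf, href, hb, hP⟩ := exists_seq_isRefinement hf P hinf
  have hsW : ∀ n x y, s (n + 1) x y → y ∈ W n (f n x) := fun n x y h =>
    hsf n x y h ▸ hxf n y
  refine ⟨s, L, ⟨h0, fun n => (href n).le, fun n => (href n).asymm, fun n => (href n).congr,
    fun n => (href n).separate⟩, fun n => (hgood n).isOpen, fun n => (hgood n).ordConnected,
    fun x O hO hxO => ?_, fun x hx => ?_⟩
  · obtain ⟨n, hn⟩ := exists_subset_of_isSmallNhd (K := fun n => {y | s (n + 1) x y})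
      (fun n => (s (n + 1)).refl x) (fun n => (hgood (n + 1)).ordConnected x)
      (fun n : ℕ => ⟨_, _, hW n (f n x), hsW n x⟩) hO hxO
    exact ⟨n + 1, hn⟩
  · obtain ⟨u, hu, v, hv, huv⟩ := hx
    obtain ⟨N, hN⟩ := exists_nat_one_div_lt (half_pos (dist_pos.2 huv))
    have hbase : ∀ n ≥ N + 1, ∀ p, s n x p →
        connectedComponent (b n p) = connectedComponent x := by
      rintro (_ | m) hn p hp
      · omega
      have hPx : P (m + 1) x := by
        refine ⟨u, hu, v, hv, ?_⟩
        have := Nat.one_div_le_one_div (α := ℝ) (show N ≤ m by omega)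
        rw [Nat.add_sub_cancel]
        linarith
      obtain ⟨u', hu', v', hv', huv'⟩ := hP _ p x ((s _).symm hp) hPx
      obtain ⟨u, hu, v, hv, huv⟩ := hPx
      have h₁ := (hW m (f m p)).mem_connectedComponent (hsW m p _ ((s _).symm hp)) hu hv huv
      have h₂ := (hW m (f m p)).mem_connectedComponent (hsW m p _ (hb _ p)) hu' hv' huv'
      exact (connectedComponent_eq h₂).trans (connectedComponent_eq h₁).symm
    refine ⟨N + 1, fun n hn p q hp hq hpq => ?_⟩
    have h := hbase n hn p hp
    have hc := (href n).compat p q ((s n).trans ((s n).symm hp) hq) hpq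
    simpa only [above, below, h] using hc

end Shrink

section TreeLT

variable {X : Type*} {s : ℕ → Setoid X} {L : ℕ → X → X → Prop}

namespace IsTournamentTree

theorem rel_of_le (h : IsTournamentTree s L) {m n : ℕ} (hmn : m ≤ n) {x y : X} (hxy : s n x y) :
    s m x y :=
  antitone_nat_of_succ_le h.le hmn hxy

theorem exists_split (h : IsTournamentTree s L) {x y : X} (hxy : ¬ ∀ n, s n x y) :
    ∃ n, s n x y ∧ ¬ s (n + 1) x y := by
  by_contra! hc
  refine hxy fun n => ?_
  induction n with
  | zero => rw [h.zero]; trivial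
  | succ n ih => exact hc n ih

end IsTournamentTree

variable [LinearOrder X]

/-- The relation read off from a tournament tree: points separated by the tree are compared at
the node where they split, all other points by the order of `X`. -/
def treeLT (s : ℕ → Setoid X) (L : ℕ → X → X → Prop) (x y : X) : Prop :=
  (∃ n, s n x y ∧ ¬ s (n + 1) x y ∧ L n x y) ∨ (∀ n, s n x y) ∧ x < y

namespace IsTournamentTree

theorem treeLT_iff (h : IsTournamentTree s L) {n : ℕ} {x y : X} (hn : s n x y)
    (hn' : ¬ s (n + 1) x y) : treeLT s L x y ↔ L n x y := by
  refine ⟨?_, fun hL => .inl ⟨n, hn, hn', hL⟩⟩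
  rintro (⟨m, hm, hm', hL⟩ | ⟨hall, -⟩)
  · obtain rfl : m = n := by
      by_contra hne
      rcases lt_or_gt_of_ne hne with hlt | hlt
      · exact hm' (h.rel_of_le hlt hn)
      · exact hn' (h.rel_of_le hlt hm)
    exact hL
  · exact (hn' (hall _)).elim

theorem treeLT_irrefl (x : X) : ¬ treeLT s L x x := by
  rintro (⟨n, -, hn, -⟩ | ⟨-, hx⟩)
  · exact hn ((s _).refl x)
  · exact lt_irrefl x hx

theorem treeLT_iff_not (h : IsTournamentTree s L) {x y : X} (hxy : x ≠ y) :
    treeLT s L x y ↔ ¬ treeLT s L y x := by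
  by_cases hall : ∀ n, s n x y
  · have hall' : ∀ n, s n y x := fun n => (s n).symm (hall n)
    have h₁ : ∀ {u v : X}, (∀ n, s n u v) → (treeLT s L u v ↔ u < v) := fun huv =>
      ⟨fun hlt => hlt.elim (fun ⟨n, _, hn, _⟩ => (hn (huv _)).elim) And.right,
        fun hlt => .inr ⟨huv, hlt⟩⟩
    rw [h₁ hall, h₁ hall', not_lt]
    exact ⟨le_of_lt, fun hle => hle.lt_of_ne hxy⟩
  · obtain ⟨n, hn, hn'⟩ := h.exists_split hall
    rw [h.treeLT_iff hn hn', h.treeLT_iff ((s n).symm hn) fun h' => hn' ((s _).symm h')]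
    exact h.asymm n x y hn hn'

/-- The nodes of a tournament tree are open in any topology in which the rays of the associated
relation are open. -/
theorem isOpen_rel [TopologicalSpace X] (h : IsTournamentTree s L)
    (hl : ∀ a, IsOpen {y | treeLT s L y a}) (hr : ∀ a, IsOpen {y | treeLT s L a y})
    (n : ℕ) (x : X) : IsOpen {y | s n x y} := by
  induction n with
  | zero =>
    have : {y | s 0 x y} = univ := eq_univ_of_forall fun y => by
      rw [mem_ofPred_eq, h.zero]; trivial
    rw [this]
    exact isOpen_univ
  | succ n ih =>
    obtain ⟨F, hF, hFx, hsep⟩ := h.separate n x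
    let H : X → Set X := fun a =>
      {y | (treeLT s L a x → treeLT s L a y) ∧ (¬ treeLT s L a x → treeLT s L y a)}
    have hH : ∀ a, IsOpen (H a) := fun a => by
      by_cases hax : treeLT s L a x
      · simpa [H, hax] using hr a
      · simpa [H, hax] using hl a
    have key : {y | s (n + 1) x y} = {y | s n x y} ∩ ⋂ a ∈ F, H a := by
      ext y
      simp only [mem_inter_iff, mem_iInter, mem_ofPred_eq]
      constructor
      · refine fun hxy => ⟨h.le n hxy, fun a ha => ?_⟩
        have hax : s n a x := (s n).symm (hFx a ha).1
        have hay' : ¬ s (n + 1) a y := fun hay => (hFx a ha).2 ((s _).trans hay ((s _).symm hxy))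
        have hiff : treeLT s L a x ↔ treeLT s L a y := by
          rw [h.treeLT_iff hax (hFx a ha).2, h.treeLT_iff ((s n).trans hax (h.le n hxy)) hay']
          exact h.congr n a a x y hax ((s _).refl a) hxy
        refine ⟨hiff.1, fun hn => (h.treeLT_iff_not ?_).2 fun hay => hn (hiff.2 hay)⟩
        rintro rfl
        exact hay' ((s _).refl _)
      · rintro ⟨hxy, hy⟩
        by_contra hxy'
        obtain ⟨a, ha, hay, hne⟩ := hsep y hxy hxy'
        have hax : s n a x := (s n).symm (hFx a ha).1
        rw [← h.treeLT_iff hax (hFx a ha).2, ← h.treeLT_iff ((s n).trans hax hxy) hay] at hne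
        by_cases hlt : treeLT s L a x
        · exact hne (iff_of_true hlt ((hy a ha).1 hlt))
        · refine hne (iff_of_false hlt fun hlt' => ?_)
          have hya := (hy a ha).2 hlt
          refine (h.treeLT_iff_not ?_).1 hlt' hya
          rintro rfl
          exact treeLT_irrefl _ hya
    rw [key]
    exact ih.inter (hF.isOpen_biInter fun a _ => hH a)

end IsTournamentTree

namespace IsSelectionTree

variable [TopologicalSpace X]

theorem rel_of_mem_connectedComponent (h : IsSelectionTree s L) {x y : X}
    (hy : y ∈ connectedComponent x) (n : ℕ) : s n x y :=
  (isClopen_of_setoid (s n) (h.isOpen n) x).connectedComponent_subset ((s n).refl x) hy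

variable [GOSpace X]

theorem mem_connectedComponent (h : IsSelectionTree s L) {x y : X} (hxy : ∀ n, s n x y) :
    y ∈ connectedComponent x := by
  by_contra hy
  obtain ⟨n, hn⟩ := h.shrink x {y}ᶜ isOpen_compl_singleton fun z hz hzy => hy (hzy ▸ hz)
  exact hn (hxy n) rfl

/-- Near a nondegenerate component `treeLT` agrees with `<` for points on both sides of some point
of the component. -/
theorem exists_forall_treeLT (h : IsSelectionTree s L) {x : X}
    (hx : (connectedComponent x).Nontrivial) :
    ∃ N, ∀ p q, s N x p → s N x q → ∀ d ∈ connectedComponent x, p ≤ d → d ≤ q → p < q →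
      treeLT s L p q := by
  obtain ⟨N, hN⟩ := h.compat x hx
  obtain ⟨A, hA⟩ : ∃ A, IsClosed (above x) → {y | s A x y} ⊆ (above x)ᶜ := by
    by_cases hcl : IsClosed (above x)
    · obtain ⟨n, hn⟩ := h.shrink x _ hcl.isOpen_compl fun z hz hz' => notMem_of_mem_above hz' hz
      exact ⟨n, fun _ => hn⟩
    · exact ⟨0, fun h' => (hcl h').elim⟩
  obtain ⟨B, hB⟩ : ∃ B, IsClosed (below x) → {y | s B x y} ⊆ (below x)ᶜ := by
    by_cases hcl : IsClosed (below x)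
    · obtain ⟨n, hn⟩ := h.shrink x _ hcl.isOpen_compl fun z hz hz' => notMem_of_mem_below hz' hz
      exact ⟨n, fun _ => hn⟩
    · exact ⟨0, fun h' => (hcl h').elim⟩
  refine ⟨max N (max A B), fun p q hp hq d hd hpd hdq hpq => ?_⟩
  by_cases hall : ∀ n, s n p q
  · exact .inr ⟨hall, hpq⟩
  obtain ⟨n, hn, hn'⟩ := h.exists_split hall
  have hNn : N ≤ n := by
    by_contra! hlt
    exact hn' (h.rel_of_le (Nat.succ_le_of_lt hlt)
      (h.rel_of_le (le_max_left _ _) ((s _).trans ((s _).symm hp) hq)))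
  have hxp : s n x p := (s n).trans (h.rel_of_mem_connectedComponent hd n)
    ((s n).symm ((h.ordConnected n p).out ((s n).refl p) hn ⟨hpd, hdq⟩))
  refine .inl ⟨n, hn, hn', hN n hNn p q hxp ((s n).trans hxp hn) hn' d hd hpd hdq ?_ ?_⟩
  · refine or_iff_not_imp_left.2 fun hpx hcl => hB hcl ?_ (mem_below_of_lt hd hpd hpx)
    exact h.rel_of_le ((le_max_right _ _).trans (le_max_right _ _)) hp
  · refine or_iff_not_imp_left.2 fun hqx hcl => hA hcl ?_ (mem_above_of_lt hd hdq hqx)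
    exact h.rel_of_le ((le_max_left _ _).trans (le_max_right _ _)) hq

theorem exists_isOpen_treeLT (h : IsSelectionTree s L) {x y : X} (hxy : treeLT s L x y) :
    ∃ U V : Set X, IsOpen U ∧ IsOpen V ∧ x ∈ U ∧ y ∈ V ∧ ∀ p ∈ U, ∀ q ∈ V, treeLT s L p q := by
  rcases hxy with ⟨n, hn, hn', hL⟩ | ⟨hall, hlt⟩
  · refine ⟨_, _, h.isOpen (n + 1) x, h.isOpen (n + 1) y, (s _).refl x, (s _).refl y,
      fun p hp q hq => .inl ⟨n, ?_, fun hpq => ?_, (h.congr n x p y q hn hp hq).1 hL⟩⟩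
    · exact (s n).trans ((s n).symm (h.le n hp)) ((s n).trans hn (h.le n hq))
    · exact hn' ((s _).trans hp ((s _).trans hpq ((s _).symm hq)))
  · have hy := h.mem_connectedComponent hall
    obtain ⟨N, hN⟩ := h.exists_forall_treeLT ⟨x, _root_.mem_connectedComponent, y, hy, hlt.ne⟩
    obtain ⟨m, hm, hmy, hxm⟩ := isPreconnected_connectedComponent (x := x) (Iio y) (Ioi x)
      (isOpen_Iio y) (isOpen_Ioi x)
      (fun z _ => (lt_or_ge z y).imp id fun hyz => hlt.trans_le hyz)
      ⟨x, _root_.mem_connectedComponent, hlt⟩ ⟨y, hy, hlt⟩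
    refine ⟨Iio m ∩ {z | s N x z}, Ioi m ∩ {z | s N x z}, (isOpen_Iio m).inter (h.isOpen N x),
      (isOpen_Ioi m).inter (h.isOpen N x), ⟨hxm, (s N).refl x⟩, ⟨hmy, hall N⟩, ?_⟩
    rintro p ⟨hpm, hp⟩ q ⟨hmq, hq⟩
    exact hN p q hp hq m hm hpm.le hmq.le (hpm.trans hmq)

/-- Any topology in which the rays of `treeLT` are open refines the topology of the space. -/
theorem le_of_isOpen_treeLT {X : Type*} {τ : TopologicalSpace X} [t : TopologicalSpace X]
    [LinearOrder X] [GOSpace X] {s : ℕ → Setoid X} {L : ℕ → X → X → Prop}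
    (h : IsSelectionTree s L) (hl : ∀ a, IsOpen[τ] {y | treeLT s L y a})
    (hr : ∀ a, IsOpen[τ] {y | treeLT s L a y}) : τ ≤ t := by
  have hcell : ∀ n x, IsOpen[τ] {y | s n x y} :=
    @IsTournamentTree.isOpen_rel X s L _ τ h.toIsTournamentTree hl hr
  intro O hO
  refine (@isOpen_iff_forall_mem_open X τ O).2 fun x hxO => ?_
  obtain ⟨V, hV, hxV, hVO, hVc⟩ := exists_ordConnected x O hO hxO
  have hx : x ∈ connectedComponent x := _root_.mem_connectedComponent
  obtain ⟨G, hG, hxG, hGV⟩ : ∃ G, IsOpen[τ] G ∧ x ∈ G ∧ ∀ y ∈ G, x ≤ y → y ∈ V := by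
    by_cases hgt : ∃ z ∈ connectedComponent x, x < z
    · obtain ⟨z, hz, hxz⟩ := hgt
      obtain ⟨w, hw, hwV, hxw⟩ := isPreconnected_connectedComponent (x := x) (V ∪ Iio x) (Ioi x)
        (hV.union (isOpen_Iio x)) (isOpen_Ioi x)
        (fun u _ => by
          rcases lt_trichotomy u x with hu | rfl | hu
          exacts [.inl (.inr hu), .inl (.inl hxV), .inr hu])
        ⟨x, hx, .inl hxV⟩ ⟨z, hz, hxz⟩
      obtain ⟨N, hN⟩ := h.exists_forall_treeLT ⟨x, hx, z, hz, hxz.ne⟩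
      refine ⟨{y | treeLT s L y w} ∩ {y | s N x y}, @IsOpen.inter X τ _ _ (hl w) (hcell N x),
        ⟨.inr ⟨h.rel_of_mem_connectedComponent hw, hxw⟩, (s N).refl x⟩, ?_⟩
      rintro y ⟨hyw, hy⟩ hxy
      refine hVc.out hxV (hwV.resolve_right hxw.not_gt) ⟨hxy, not_lt.1 fun hwy => ?_⟩
      exact (h.treeLT_iff_not hwy.ne').1 hyw
        (hN w y (h.rel_of_mem_connectedComponent hw N) hy w hw le_rfl hwy.le hwy)
    · push Not at hgt
      obtain ⟨n, hn⟩ := h.shrink x (V ∪ Iio x) (hV.union (isOpen_Iio x)) fun u hu =>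
        (hgt u hu).eq_or_lt.imp (fun e : u = x => e ▸ hxV) id
      exact ⟨_, hcell n x, (s n).refl x, fun y hy hxy => (hn hy).resolve_right hxy.not_gt⟩
  obtain ⟨G', hG', hxG', hGV'⟩ : ∃ G, IsOpen[τ] G ∧ x ∈ G ∧ ∀ y ∈ G, y ≤ x → y ∈ V := by
    by_cases hgt : ∃ z ∈ connectedComponent x, z < x
    · obtain ⟨z, hz, hxz⟩ := hgt
      obtain ⟨w, hw, hwV, hxw⟩ := isPreconnected_connectedComponent (x := x) (V ∪ Ioi x) (Iio x)
        (hV.union (isOpen_Ioi x)) (isOpen_Iio x)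
        (fun u _ => by
          rcases lt_trichotomy u x with hu | rfl | hu
          exacts [.inr hu, .inl (.inl hxV), .inl (.inr hu)])
        ⟨x, hx, .inl hxV⟩ ⟨z, hz, hxz⟩
      obtain ⟨N, hN⟩ := h.exists_forall_treeLT ⟨x, hx, z, hz, hxz.ne'⟩
      refine ⟨{y | treeLT s L w y} ∩ {y | s N x y}, @IsOpen.inter X τ _ _ (hr w) (hcell N x),
        ⟨.inr ⟨fun n => (s n).symm (h.rel_of_mem_connectedComponent hw n), hxw⟩, (s N).refl x⟩, ?_⟩
      rintro y ⟨hyw, hy⟩ hxy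
      refine hVc.out (hwV.resolve_right hxw.not_gt) hxV ⟨not_lt.1 fun hwy => ?_, hxy⟩
      exact (h.treeLT_iff_not hwy.ne').1 hyw
        (hN y w hy (h.rel_of_mem_connectedComponent hw N) w hw hwy.le le_rfl hwy)
    · push Not at hgt
      obtain ⟨n, hn⟩ := h.shrink x (V ∪ Ioi x) (hV.union (isOpen_Ioi x)) fun u hu =>
        (hgt u hu).eq_or_lt.imp (fun e : x = u => e ▸ hxV) id
      exact ⟨_, hcell n x, (s n).refl x, fun y hy hxy => (hn hy).resolve_right hxy.not_gt⟩
  refine ⟨G ∩ G', fun y hy => hVO ?_, @IsOpen.inter X τ _ _ hG hG', hxG, hxG'⟩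
  exact (le_total x y).elim (hGV y hy.1) (hGV' y hy.2)

end IsSelectionTree

end TreeLT

end GOSpace

theorem WeakSelection.exists_lt_iff {X : Type*} {R : X → X → Prop} (hirr : ∀ x, ¬ R x x)
    (hR : ∀ x y, x ≠ y → (R x y ↔ ¬ R y x)) : ∃ σ : WeakSelection X, ∀ x y, σ.lt x y ↔ R x y := by
  classical
  refine ⟨⟨fun x y => if R x y then x else y, fun x y => ?_, fun x y => ?_⟩, fun x y => ?_⟩
  · by_cases h : R x y <;> simp [h]
  · by_cases hxy : x = y
    · rw [hxy]
    · have := hR x y hxy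
      by_cases h : R x y
      · simp [h, this.1 h]
      · simp [h, not_not.1 (mt this.2 h)]
  · by_cases hxy : x = y
    · simp [lt, le, hxy, hirr]
    · by_cases h : R x y
      · simp [lt, le, hxy, h]
      · simp [lt, le, h, Ne.symm hxy]

theorem supSelTop_singleton {X : Type*} (σ : WeakSelection X) : supSelTop {σ} = σ.selTop := by
  rw [supSelTop, biUnion_singleton]
  exact TopologicalSpace.generateFrom_setOfPred_isOpen _

theorem cws_eq_one {X : Type*} [t : TopologicalSpace X] [T0Space X] [Nontrivial X]
    {σ : WeakSelection X} (hσ : σ.Continuous) (ht : σ.selTop = t) : cws X = 1 := by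
  refine le_antisymm (csInf_le' ⟨{σ}, ?_, (supSelTop_singleton σ).trans ht, by simp⟩)
    (le_csInf ⟨_, {σ}, ?_, (supSelTop_singleton σ).trans ht, rfl⟩ ?_)
  · simpa using hσ
  · simpa using hσ
  · rintro _ ⟨Sig, -, hSig, rfl⟩
    rw [Cardinal.one_le_iff_ne_zero, Cardinal.mk_ne_zero_iff]
    by_contra hemp
    rw [not_nonempty_iff, isEmpty_coe_sort] at hemp
    subst hemp
    have htop : t = ⊤ := by
      rw [← hSig, supSelTop, biUnion_empty, eq_top_iff]
      exact le_generateFrom fun _ h => h.elim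
    obtain ⟨x, y, hxy⟩ := exists_pair_ne X
    exact hxy (Inseparable.eq (by rw [Inseparable, htop, nhds_top, nhds_top]))

/-- A metrizable GO-space with infinitely many components has a continuous weak selection inducing
its topology. -/
theorem GOSpace.exists_weakSelection {X : Type*} [t : TopologicalSpace X] [LinearOrder X]
    [GOSpace X] [TopologicalSpace.MetrizableSpace X]
    (hinf : (range fun x : X => connectedComponent x).Infinite) :
    ∃ σ : WeakSelection X, σ.Continuous ∧ σ.selTop = t := by
  obtain ⟨s, L, h⟩ : ∃ (s : ℕ → Setoid X) (L : ℕ → X → X → Prop), IsSelectionTree s L := by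
    let := TopologicalSpace.metrizableSpaceMetric X
    exact exists_isSelectionTree hinf
  obtain ⟨σ, hσ⟩ := WeakSelection.exists_lt_iff IsTournamentTree.treeLT_irrefl
    fun x y hxy => h.treeLT_iff_not hxy
  have hcont : σ.Continuous := fun x y hxy => by
    simp only [hσ] at hxy ⊢
    exact h.exists_isOpen_treeLT hxy
  refine ⟨σ, hcont, le_antisymm ?_ (le_generateFrom ?_)⟩
  · refine h.le_of_isOpen_treeLT (fun a => ?_) fun a => ?_
    · exact TopologicalSpace.isOpen_generateFrom_of_mem ⟨a, .inl (by simp only [hσ])⟩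
    · exact TopologicalSpace.isOpen_generateFrom_of_mem ⟨a, .inr (by simp only [hσ])⟩
  · rintro _ ⟨a, rfl | rfl⟩ <;> refine isOpen_iff_forall_mem_open.2 fun x hx => ?_
    · obtain ⟨U, V, hU, -, hxU, haV, hUV⟩ := hcont x a hx
      exact ⟨U, fun y hy => hUV y hy a haV, hU, hxU⟩
    · obtain ⟨U, V, -, hV, haU, hxV, hUV⟩ := hcont a x hx
      exact ⟨V, fun y hy => hUV a haU y hy, hV, hxV⟩

/-- Theorem 5.1: a suborderable metrizable Hausdorff space with infinitely many
connected components has `cws X = 1`; that is, there is a continuous weak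
selection whose selection topology is the topology of `X`. -/
theorem stmt17 {X : Type*} [t : TopologicalSpace X] [T2Space X]
    (hmet : TopologicalSpace.MetrizableSpace X) (hsub : Suborderable X)
    (hinf : (Set.range fun x : X => connectedComponent x).Infinite) :
    cws X = 1 ∧ ∃ σ : WeakSelection X, σ.Continuous ∧ σ.selTop = t := by
  obtain ⟨l, hl, hr, hc⟩ := hsub
  have : GOSpace X := ⟨hl, hr, fun x U hU hx => by
    obtain ⟨V, hV, hxV, hVU, hconv⟩ := hc x U hU hx
    exact ⟨V, hV, hxV, hVU, ⟨fun a ha b hb c hc => hconv a ha b hb c hc.1 hc.2⟩⟩⟩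
  obtain ⟨σ, hσ, ht⟩ := GOSpace.exists_weakSelection hinf
  have : Infinite X := infinite_univ_iff.1 fun h => hinf (by
    simpa only [image_univ] using h.image fun x : X => connectedComponent x)
  exact ⟨cws_eq_one hσ ht, σ, hσ, ht⟩
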